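/- arXiv:2506.01589 — 2 statements merged into one kernel-verified Lean document; each statement's English description precedes it below -/
import Mathlib

section
/- Every triangle-free matchstick graph on n vertices has at most 2n - (√2/5)·√n edges. (Upper bound of Theorem 1.) -/
/-- A *matchstick embedding* (drawing) of a simple graph `G`: the vertices are
represented by distinct points of the Euclidean plane, every edge is a
straight-line segment of unit length, two segments representing distinct edges
intersect in at most a common endpoint, and no vertex point lies in the
relative interior (open segment) of any edge segment. A graph admitting such an
embedding is a *matchstick graph*. -/
structure MatchstickEmbedding {V : Type*} (G : SimpleGraph V) where
  /-- the position of each vertex in the plane -/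
  pos : V → EuclideanSpace ℝ (Fin 2)
  /-- the vertex points are distinct -/
  inj : Function.Injective pos
  /-- every edge has unit length -/
  unit : ∀ u v : V, G.Adj u v → dist (pos u) (pos v) = 1
  /-- no vertex lies in the relative interior of an edge segment -/
  noVertexInterior : ∀ w u v : V, G.Adj u v → pos w ∉ openSegment ℝ (pos u) (pos v)
  /-- segments of distinct edges intersect in at most a common endpoint -/
  noncross : ∀ u v a b : V, G.Adj u v → G.Adj a b → s(u, v) ≠ s(a, b) →
    segment ℝ (pos u) (pos v) ∩ segment ℝ (pos a) (pos b) ⊆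
      ({pos u, pos v} ∩ {pos a, pos b} : Set (EuclideanSpace ℝ (Fin 2)))


/-- Abstract sweep system: a finite family of `x`-monotone non-crossing arcs. -/
structure SweepSys (E V : Type) where
  s : E → V
  t : E → V
  X : V → ℝ
  Y : V → ℝ
  h : E → ℝ → ℝ
  xinj : Function.Injective X
  lt : ∀ e, X (s e) < X (t e)
  hc : ∀ e, Continuous (h e)
  hs : ∀ e, h e (X (s e)) = Y (s e)
  ht : ∀ e, h e (X (t e)) = Y (t e)
  nv : ∀ e v, X (s e) < X v → X v < X (t e) → h e (X v) ≠ Y v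
  nc : ∀ e f, e ≠ f → ∀ x, X (s e) < x → x < X (t e) → X (s f) < x → x < X (t f) → h e x ≠ h f x

namespace SweepSys

variable {E V : Type} (S : SweepSys E V)

/-- Height function with values in the extended reals; `inr false` is the bottom, `inr true` the top. -/
noncomputable def H : E ⊕ Bool → ℝ → EReal
  | Sum.inl e, x => (S.h e x : EReal)
  | Sum.inr false, _ => ⊥
  | Sum.inr true, _ => ⊤

/-- An arc is active at `x` if `x` is in the interior of its range. -/
def act : E ⊕ Bool → ℝ → Prop
  | Sum.inl e, x => S.X (S.s e) < x ∧ x < S.X (S.t e)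
  | Sum.inr _, _ => True

/-- Genericity of an abscissa. -/
def gen (x : ℝ) : Prop := ∀ v, x ≠ S.X v

/-- `b` is immediately above `a` at `x`. -/
def Vis (x : ℝ) (a b : E ⊕ Bool) : Prop :=
  S.act a x ∧ S.act b x ∧ S.H a x < S.H b x ∧
    ∀ c, S.act c x → S.H c x ≤ S.H a x ∨ S.H b x ≤ S.H c x

lemma sign_persist {g : ℝ → ℝ} (hg : Continuous g) {x x' : ℝ}
    (h0 : ∀ y ∈ Set.uIcc x x', g y ≠ 0) : 0 < g x ↔ 0 < g x' := by
  have key : ∀ p ∈ Set.uIcc x x', ∀ q ∈ Set.uIcc x x', 0 < g p → 0 < g q := by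
    intro p hp q hq h1
    by_contra h2
    push Not at h2
    have := (Set.ordConnected_uIcc (a := x) (b := x')).isPreconnected.intermediate_value hq hp
      hg.continuousOn
    obtain ⟨y, hy, hy0⟩ := this ⟨h2, h1.le⟩
    exact h0 y hy hy0
  exact ⟨key _ Set.left_mem_uIcc _ Set.right_mem_uIcc, key _ Set.right_mem_uIcc _ Set.left_mem_uIcc⟩

lemma H_ne {a b : E ⊕ Bool} (hab : a ≠ b) {x : ℝ} (ha : S.act a x) (hb : S.act b x) :
    S.H a x ≠ S.H b x := by
  rcases a with e | (_ | _) <;> rcases b with f | (_ | _) <;> simp [H] at *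
  exact S.nc e f hab x ha.1 ha.2 hb.1 hb.2

lemma act_mid {a : E ⊕ Bool} {x x' y : ℝ} (h1 : S.act a x) (h2 : S.act a x')
    (hy : y ∈ Set.uIcc x x') : S.act a y := by
  rcases a with e | b
  · rcases Set.mem_uIcc.1 hy with h | h
    · exact ⟨h1.1.trans_le h.1, h.2.trans_lt h2.2⟩
    · exact ⟨h2.1.trans_le h.1, h.2.trans_lt h1.2⟩
  · trivial

lemma order_persist {a b : E ⊕ Bool} {x x' : ℝ} (ha : S.act a x) (ha' : S.act a x')
    (hb : S.act b x) (hb' : S.act b x') : S.H a x < S.H b x ↔ S.H a x' < S.H b x' := by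
  by_cases hab : a = b
  · subst hab; simp
  rcases a with e | (_ | _) <;> rcases b with f | (_ | _) <;> simp only [H] <;> try simp
  have := sign_persist (g := fun y => S.h f y - S.h e y) ((S.hc f).sub (S.hc e)) (x := x) (x' := x') (by
    intro y hy h0
    have h1 := S.act_mid ha ha' hy
    have h2 := S.act_mid hb hb' hy
    exact S.nc e f (by simpa using hab) y h1.1 h1.2 h2.1 h2.2 (by linarith))
  simpa using this

/-- If `g` is an arc with value `Y v` at the abscissa of `v`, then the order relative to an arc active there
is the order relative to `v`. -/
lemma order_vertex {a : E ⊕ Bool} {f : E} {v : V} {x : ℝ} (hf : S.h f (S.X v) = S.Y v)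
    (hfa : ∀ y ∈ Set.uIcc (S.X v) x, y ≠ S.X v → S.act (Sum.inl f) y)
    (hax : S.act a x) (hav : S.act a (S.X v)) (hne : a ≠ Sum.inl f) :
    (S.H a x < S.h f x ↔ S.H a (S.X v) < S.Y v) ∧
    ((S.h f x : EReal) < S.H a x ↔ (S.Y v : EReal) < S.H a (S.X v)) := by
  rcases a with e | (_ | _) <;> simp only [H] <;> try simp
  have h0 : ∀ y ∈ Set.uIcc (S.X v) x, S.h f y ≠ S.h e y := by
    intro y hy h0
    have h1 := S.act_mid hav hax hy
    by_cases hyv : y = S.X v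
    · subst hyv
      rw [hf] at h0
      exact S.nv e v hav.1 hav.2 h0.symm
    · have h2 := hfa y hy hyv
      exact S.nc e f (by simpa using hne) y h1.1 h1.2 h2.1 h2.2 h0.symm
  have k1 := sign_persist (g := fun y => S.h f y - S.h e y) ((S.hc f).sub (S.hc e)) (x := S.X v) (x' := x)
    (fun y hy h => h0 y hy (by linarith))
  have k2 := sign_persist (g := fun y => S.h e y - S.h f y) ((S.hc e).sub (S.hc f)) (x := S.X v) (x' := x)
    (fun y hy h => h0 y hy (by linarith))
  simp only [sub_pos, hf] at k1 k2
  exact ⟨k1.symm, k2.symm⟩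

lemma vis_low_unique {x : ℝ} {a a' b : E ⊕ Bool} (h : S.Vis x a b) (h' : S.Vis x a' b) : a = a' := by
  by_contra hne
  have := S.H_ne hne h.1 h'.1
  rcases h.2.2.2 a' h'.1 with k | k
  · rcases h'.2.2.2 a h.1 with k' | k'
    · exact this (le_antisymm k' k)
    · exact absurd h.2.2.1 (not_lt.2 k')
  · exact absurd h'.2.2.1 (not_lt.2 k)

lemma vis_high_unique {x : ℝ} {a b b' : E ⊕ Bool} (h : S.Vis x a b) (h' : S.Vis x a b') : b = b' := by
  by_contra hne
  have := S.H_ne hne h.2.1 h'.2.1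
  rcases h.2.2.2 b' h'.2.1 with k | k
  · exact absurd h'.2.2.1 (not_lt.2 k)
  · rcases h'.2.2.2 b h.2.1 with k' | k'
    · exact absurd h.2.2.1 (not_lt.2 k')
    · exact this (le_antisymm k k')

lemma vis_strip {x x' : ℝ} (hx : S.gen x) (hx' : S.gen x') (hs : ∀ w, S.X w < x ↔ S.X w < x')
    {a b : E ⊕ Bool} (h : S.Vis x a b) : S.Vis x' a b := by
  have hs' : ∀ w, x < S.X w ↔ x' < S.X w := by
    intro w
    have := hs w
    constructor
    · intro h; exact lt_of_le_of_ne (not_lt.1 fun k => (this.2 k).not_gt h) (hx' w)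
    · intro h; exact lt_of_le_of_ne (not_lt.1 fun k => (this.1 k).not_gt h) (hx w)
  have hact : ∀ c, S.act c x ↔ S.act c x' := by
    rintro (e | b)
    · simp only [act, hs, hs']
    · simp [act]
  obtain ⟨h1, h2, h3, h4⟩ := h
  refine ⟨(hact a).1 h1, (hact b).1 h2, (S.order_persist h1 ((hact a).1 h1) h2 ((hact b).1 h2)).1 h3, ?_⟩
  intro c hc
  have hc0 := (hact c).2 hc
  rcases h4 c hc0 with k | k
  · left
    rw [← not_lt] at k ⊢
    rwa [← S.order_persist h1 ((hact a).1 h1) hc0 hc]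
  · right
    rw [← not_lt] at k ⊢
    rwa [← S.order_persist hc0 hc h2 ((hact b).1 h2)]

variable [Fintype E] [Fintype V]

lemma exists_right (v : V) : ∃ x, S.X v < x ∧ ∀ w, S.X w ≤ x → S.X w ≤ S.X v := by
  classical
  by_cases hne : ((Finset.univ : Finset V).filter (fun w => S.X v < S.X w)).Nonempty
  · obtain ⟨w, hw, hm⟩ := Finset.exists_min_image _ S.X hne
    simp only [Finset.mem_filter, Finset.mem_univ, true_and] at hw hm
    refine ⟨(S.X v + S.X w) / 2, by linarith, fun u hu => ?_⟩
    by_contra hlt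
    have := hm u (not_le.1 hlt)
    linarith
  · rw [Finset.not_nonempty_iff_eq_empty, Finset.filter_eq_empty_iff] at hne
    exact ⟨S.X v + 1, by linarith, fun w _ => not_lt.1 (hne (Finset.mem_univ w))⟩

lemma exists_left (v : V) : ∃ x, x < S.X v ∧ ∀ w, x ≤ S.X w → S.X v ≤ S.X w := by
  classical
  by_cases hne : ((Finset.univ : Finset V).filter (fun w => S.X w < S.X v)).Nonempty
  · obtain ⟨w, hw, hm⟩ := Finset.exists_max_image _ S.X hne
    simp only [Finset.mem_filter, Finset.mem_univ, true_and] at hw hm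
    refine ⟨(S.X v + S.X w) / 2, by linarith, fun u hu => ?_⟩
    by_contra hlt
    have := hm u (not_le.1 hlt)
    linarith
  · rw [Finset.not_nonempty_iff_eq_empty, Finset.filter_eq_empty_iff] at hne
    exact ⟨S.X v - 1, by linarith, fun w _ => not_lt.1 (hne (Finset.mem_univ w))⟩

/-- abscissa just to the right of `v` -/
noncomputable def R (v : V) : ℝ := (S.exists_right v).choose
/-- abscissa just to the left of `v` -/
noncomputable def L (v : V) : ℝ := (S.exists_left v).choose

lemma R_gt (v : V) : S.X v < S.R v := (S.exists_right v).choose_spec.1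
lemma R_spec (v w : V) : S.X w ≤ S.R v → S.X w ≤ S.X v := (S.exists_right v).choose_spec.2 w
lemma L_lt (v : V) : S.L v < S.X v := (S.exists_left v).choose_spec.1
lemma L_spec (v w : V) : S.L v ≤ S.X w → S.X v ≤ S.X w := (S.exists_left v).choose_spec.2 w

lemma gen_R (v : V) : S.gen (S.R v) := fun w h => by
  have := S.R_spec v w h.ge
  have := S.R_gt v
  linarith
lemma gen_L (v : V) : S.gen (S.L v) := fun w h => by
  have := S.L_spec v w h.le
  have := S.L_lt v
  linarith

lemma act_R (e : E) (v : V) : S.act (Sum.inl e) (S.R v) ↔ S.X (S.s e) ≤ S.X v ∧ S.X v < S.X (S.t e) := by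
  simp only [act]
  constructor
  · rintro ⟨h1, h2⟩
    exact ⟨S.R_spec v _ h1.le, (S.R_gt v).trans h2⟩
  · rintro ⟨h1, h2⟩
    refine ⟨h1.trans_lt (S.R_gt v), ?_⟩
    by_contra h
    have := S.R_spec v _ (not_lt.1 h)
    linarith

lemma act_L (e : E) (v : V) : S.act (Sum.inl e) (S.L v) ↔ S.X (S.s e) < S.X v ∧ S.X v ≤ S.X (S.t e) := by
  simp only [act]
  constructor
  · rintro ⟨h1, h2⟩
    exact ⟨h1.trans (S.L_lt v), S.L_spec v _ h2.le⟩
  · rintro ⟨h1, h2⟩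
    refine ⟨?_, (S.L_lt v).trans_le h2⟩
    by_contra h
    have := S.L_spec v _ (not_lt.1 h)
    linarith

/-- The arc `a` starts at `v`. -/
def starts (a : E ⊕ Bool) (v : V) : Prop := ∃ e, a = Sum.inl e ∧ S.s e = v

lemma act_of_not_starts {a : E ⊕ Bool} {v : V} (h : S.act a (S.R v)) (hs : ¬ S.starts a v) :
    S.act a (S.X v) ∧ S.act a (S.L v) := by
  rcases a with e | b
  · have h' := (S.act_R e v).1 h
    have hne : S.s e ≠ v := fun k => hs ⟨e, rfl, k⟩
    have hlt : S.X (S.s e) < S.X v := lt_of_le_of_ne h'.1 (fun k => hne (S.xinj k))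
    exact ⟨⟨hlt, h'.2⟩, (S.act_L e v).2 ⟨hlt, h'.2.le⟩⟩
  · exact ⟨trivial, trivial⟩

/-- The pair becomes visible at `v`. -/
def New (v : V) (a b : E ⊕ Bool) : Prop := S.Vis (S.R v) a b ∧ ¬ S.Vis (S.L v) a b

lemma vis_new {x : ℝ} (hx : S.gen x) {a b : E ⊕ Bool} (h : S.Vis x a b) :
    (a = Sum.inr false ∧ b = Sum.inr true) ∨ ∃ v, S.New v a b := by
  classical
  induction hk : ((Finset.univ : Finset V).filter (fun w => S.X w < x)).card using Nat.strong_induction_on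
    generalizing x with
  | _ k ih =>
  by_cases hne : ((Finset.univ : Finset V).filter (fun w => S.X w < x)).Nonempty
  · obtain ⟨v, hv, hm⟩ := Finset.exists_max_image _ S.X hne
    simp only [Finset.mem_filter, Finset.mem_univ, true_and] at hv hm
    have hR : S.Vis (S.R v) a b := by
      refine S.vis_strip hx (S.gen_R v) (fun w => ⟨fun hw => (hm w hw).trans_lt (S.R_gt v), fun hw => ?_⟩) h
      exact (S.R_spec v w hw.le).trans_lt hv
    by_cases hL : S.Vis (S.L v) a b
    · refine ih _ ?_ (S.gen_L v) hL rfl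
      rw [← hk]
      apply Finset.card_lt_card
      rw [Finset.ssubset_iff_of_subset]
      · exact ⟨v, by simpa using hv, by simpa using (S.L_lt v).le⟩
      · intro w hw
        simp only [Finset.mem_filter, Finset.mem_univ, true_and] at hw ⊢
        exact hw.trans ((S.L_lt v).trans hv)
    · exact Or.inr ⟨v, hR, hL⟩
  · left
    rw [Finset.not_nonempty_iff_eq_empty, Finset.filter_eq_empty_iff] at hne
    have hna : ∀ e, ¬ S.act (Sum.inl e) x := fun e he => hne (Finset.mem_univ (S.s e)) he.1
    obtain ⟨h1, h2, h3, -⟩ := h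
    rcases a with e | (_ | _)
    · exact absurd h1 (hna e)
    · rcases b with e | (_ | _)
      · exact absurd h2 (hna e)
      · simp [H] at h3
      · exact ⟨rfl, rfl⟩
    · simp [H] at h3

lemma order_start {a : E ⊕ Bool} {f : E} {v : V} (hf : S.s f = v) (ha : S.act a (S.R v))
    (hs : ¬ S.starts a v) :
    (S.H a (S.R v) < S.h f (S.R v) ↔ S.H a (S.X v) < S.Y v) ∧
    ((S.h f (S.R v) : EReal) < S.H a (S.R v) ↔ (S.Y v : EReal) < S.H a (S.X v)) := by
  refine S.order_vertex (by rw [← hf]; exact S.hs f) ?_ ha (S.act_of_not_starts ha hs).1 ?_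
  · intro y hy hne
    rw [Set.uIcc_of_le (S.R_gt v).le] at hy
    have h1 := (S.act_R f v).2 ⟨by rw [hf], by rw [← hf]; exact S.lt f⟩
    exact ⟨by rw [hf]; exact lt_of_le_of_ne hy.1 (Ne.symm hne), hy.2.trans_lt h1.2⟩
  · rintro rfl
    exact hs ⟨f, rfl, hf⟩

lemma order_end {a : E ⊕ Bool} {f : E} {v : V} (hf : S.t f = v) (ha : S.act a (S.L v))
    (ha' : S.act a (S.X v)) :
    (S.H a (S.L v) < S.h f (S.L v) ↔ S.H a (S.X v) < S.Y v) ∧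
    ((S.h f (S.L v) : EReal) < S.H a (S.L v) ↔ (S.Y v : EReal) < S.H a (S.X v)) := by
  refine S.order_vertex (by rw [← hf]; exact S.ht f) ?_ ha ha' ?_
  · intro y hy hne
    rw [Set.uIcc_of_ge (S.L_lt v).le] at hy
    have h1 := (S.act_L f v).2 ⟨by rw [← hf]; exact S.lt f, by rw [hf]⟩
    exact ⟨h1.1.trans_le hy.1, by rw [hf]; exact lt_of_le_of_ne hy.2 hne⟩
  · rintro rfl
    have := ha'.2
    rw [hf] at this
    exact lt_irrefl _ this

lemma new_spec {v : V} {a b : E ⊕ Bool} (h : S.New v a b) (hb : ¬ S.starts b v) :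
    (S.Y v : EReal) < S.H b (S.X v) ∧
    (S.starts a v ∨ (¬ S.starts a v ∧ S.H a (S.X v) < S.Y v ∧ ∀ f, S.s f ≠ v)) := by
  obtain ⟨⟨h1, h2, h3, h4⟩, hn⟩ := h
  by_cases ha : S.starts a v
  · refine ⟨?_, Or.inl ha⟩
    obtain ⟨f, rfl, hf⟩ := ha
    exact (S.order_start hf h2 hb).2.1 h3
  · obtain ⟨ax, aL⟩ := S.act_of_not_starts h1 ha
    obtain ⟨bx, bL⟩ := S.act_of_not_starts h2 hb
    have h3L : S.H a (S.L v) < S.H b (S.L v) := (S.order_persist h1 aL h2 bL).1 h3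
    have : ∃ c, S.act c (S.L v) ∧ S.H a (S.L v) < S.H c (S.L v) ∧ S.H c (S.L v) < S.H b (S.L v) := by
      by_contra hcon
      push Not at hcon
      refine hn ⟨aL, bL, h3L, fun c hc => ?_⟩
      by_cases k : S.H c (S.L v) ≤ S.H a (S.L v)
      · exact Or.inl k
      · exact Or.inr (hcon c hc (not_le.1 k))
    obtain ⟨c, cL, hac, hcb⟩ := this
    have hcR : ¬ S.act c (S.R v) := by
      intro cR
      rcases h4 c cR with k | k
      · exact absurd ((S.order_persist aL h1 cL cR).1 hac) (not_lt.2 k)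
      · exact absurd ((S.order_persist cL cR bL h2).1 hcb) (not_lt.2 k)
    rcases c with f | c
    · have hft : S.t f = v := by
        have k1 := (S.act_L f v).1 cL
        rw [S.act_R] at hcR
        apply S.xinj
        by_contra hne
        exact hcR ⟨k1.1.le, lt_of_le_of_ne k1.2 (Ne.symm hne)⟩
      have hav := (S.order_end hft aL ax).1.1 hac
      have hbv := (S.order_end hft bL bx).2.1 hcb
      refine ⟨hbv, Or.inr ⟨ha, hav, fun g hg => ?_⟩⟩
      have gR : S.act (Sum.inl g) (S.R v) := (S.act_R g v).2 ⟨by rw [hg], by rw [← hg]; exact S.lt g⟩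
      rcases h4 _ gR with k | k
      · exact absurd ((S.order_start hg h1 ha).1.2 hav) (not_lt.2 k)
      · exact absurd ((S.order_start hg h2 hb).2.2 hbv) (not_lt.2 k)
    · exact absurd trivial hcR

lemma new_unique {v : V} {a b a' b' : E ⊕ Bool} (h : S.New v a b) (hb : ¬ S.starts b v)
    (h' : S.New v a' b') (hb' : ¬ S.starts b' v) : a = a' ∧ b = b' := by
  have key : ∀ {a b a' b' : E ⊕ Bool}, S.New v a b → ¬ S.starts b v → S.New v a' b' → ¬ S.starts b' v →
      S.H b (S.R v) ≤ S.H b' (S.R v) := by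
    intro a b a' b' h hb h' hb'
    have k := S.new_spec h hb
    have k' := S.new_spec h' hb'
    have hlt : S.H a (S.R v) < S.H b' (S.R v) := by
      rcases k.2 with ⟨f, rfl, hf⟩ | ⟨ha, hav, -⟩
      · exact (S.order_start hf h'.1.2.1 hb').2.2 k'.1
      · have A := S.act_of_not_starts h.1.1 ha
        have B := S.act_of_not_starts h'.1.2.1 hb'
        exact (S.order_persist A.1 h.1.1 B.1 h'.1.2.1).1 (hav.trans k'.1)
    rcases h.1.2.2.2 b' h'.1.2.1 with q | q
    · exact absurd hlt (not_lt.2 q)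
    · exact q
  have hbb : b = b' := by
    by_contra hne
    exact S.H_ne hne h.1.2.1 h'.1.2.1 (le_antisymm (key h hb h' hb') (key h' hb' h hb))
  subst hbb
  exact ⟨S.vis_low_unique h.1 h'.1, rfl⟩

/-- Pairs visible somewhere, apart from (bottom, top). -/
def VPair : Type := {p : (E ⊕ Bool) × (E ⊕ Bool) // ∃ v, S.New v p.1 p.2}

noncomputable instance : Fintype S.VPair := by
  classical
  exact inferInstanceAs (Fintype {p : (E ⊕ Bool) × (E ⊕ Bool) // ∃ v, S.New v p.1 p.2})

lemma card_VPair : Fintype.card S.VPair ≤ Fintype.card V + Fintype.card E := by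
  classical
  rw [← Fintype.card_sum]
  have hch : ∀ p : S.VPair, ∃ c : V ⊕ E,
      (∃ e, c = Sum.inr e ∧ p.1.2 = Sum.inl e ∧ S.New (S.s e) p.1.1 p.1.2) ∨
      (∃ v, c = Sum.inl v ∧ ¬ S.starts p.1.2 v ∧ S.New v p.1.1 p.1.2) := by
    rintro ⟨⟨a, b⟩, v, hv⟩
    by_cases hb : S.starts b v
    · obtain ⟨e, rfl, rfl⟩ := hb
      exact ⟨Sum.inr e, Or.inl ⟨e, rfl, rfl, hv⟩⟩
    · exact ⟨Sum.inl v, Or.inr ⟨v, rfl, hb, hv⟩⟩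
  choose c hc using hch
  apply Fintype.card_le_of_injective c
  intro p q hpq
  apply Subtype.ext
  have hp := hc p
  have hq := hc q
  rw [hpq] at hp
  rcases hp with ⟨e, h1, h2, h3⟩ | ⟨v, h1, h2, h3⟩ <;> rcases hq with ⟨e', h1', h2', h3'⟩ | ⟨v', h1', h2', h3'⟩
  · have : e = e' := by simpa using h1.symm.trans h1'
    subst this
    have hh : p.1.2 = q.1.2 := h2.trans h2'.symm
    refine Prod.ext ?_ hh
    have k1 := h3.1
    rw [hh] at k1
    exact S.vis_low_unique k1 h3'.1
  · simp [h1] at h1'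
  · simp [h1] at h1'
  · have : v = v' := by simpa using h1.symm.trans h1'
    subst this
    obtain ⟨k1, k2⟩ := S.new_unique h3 h2 h3' h2'
    exact Prod.ext k1 k2

end SweepSys


lemma card_le_card_quot {N I : Type} [Fintype N] [Fintype I] (p q : I → N) (r : N → N → Prop)
    (hr : ∀ x y, r x y → x = y ∨ ∃ i, p i = x ∧ q i = y) [Fintype (Quot r)] :
    Fintype.card N ≤ Fintype.card I + Fintype.card (Quot r) := by
  classical
  let φ : (N → ℚ) →ₗ[ℚ] (I → ℚ) := LinearMap.funLeft ℚ ℚ p - LinearMap.funLeft ℚ ℚ q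
  let ψ : (Quot r → ℚ) →ₗ[ℚ] (N → ℚ) := LinearMap.funLeft ℚ ℚ (Quot.mk r)
  have h1 := LinearMap.finrank_range_add_finrank_ker φ
  have h2 : Module.finrank ℚ (LinearMap.range φ) ≤ Fintype.card I := by
    have := Submodule.finrank_le (LinearMap.range φ)
    simpa using this
  have h3 : LinearMap.ker φ ≤ LinearMap.range ψ := by
    intro g hg
    have hg' : ∀ i, g (p i) = g (q i) := by
      intro i
      have := congrFun (LinearMap.mem_ker.1 hg) i
      simp only [φ, LinearMap.sub_apply, LinearMap.funLeft_apply, Pi.sub_apply, Pi.zero_apply] at this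
      linarith
    refine ⟨Quot.lift g ?_, ?_⟩
    · intro x y hxy
      rcases hr x y hxy with rfl | ⟨i, rfl, rfl⟩
      · rfl
      · exact hg' i
    · ext x
      simp [ψ, LinearMap.funLeft_apply]
  have h4 : Module.finrank ℚ (LinearMap.ker φ) ≤ Fintype.card (Quot r) := by
    calc _ ≤ Module.finrank ℚ (LinearMap.range ψ) := Submodule.finrank_mono h3
      _ ≤ Module.finrank ℚ (Quot r → ℚ) := LinearMap.finrank_range_le ψ
      _ = _ := by simp
  have h5 : Module.finrank ℚ (N → ℚ) = Fintype.card N := by simp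
  omega

namespace SweepSys

variable {E V : Type} (S : SweepSys E V)

/-- upper side of an arc -/
def up : E ⊕ Bool → Option (E × Bool)
  | Sum.inl e => some (e, true)
  | Sum.inr _ => none
/-- lower side of an arc -/
def dn : E ⊕ Bool → Option (E × Bool)
  | Sum.inl e => some (e, false)
  | Sum.inr _ => none

/-- sides seeing each other -/
def rel (m n : Option (E × Bool)) : Prop := ∃ x a b, S.gen x ∧ S.Vis x a b ∧ m = up a ∧ n = dn b

/-- faces -/
abbrev Face : Type := Quot S.rel

/-- side to face -/
abbrev fc (m : Option (E × Bool)) : S.Face := Quot.mk _ m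

/-- upper sides of the face -/
def U (q : S.Face) (e : E) : Prop := S.fc (some (e, true)) = q
/-- lower sides of the face -/
def D (q : S.Face) (e : E) : Prop := S.fc (some (e, false)) = q

lemma fc_eq {x : ℝ} {a b : E ⊕ Bool} (hx : S.gen x) (h : S.Vis x a b) : S.fc (up a) = S.fc (dn b) :=
  Quot.sound ⟨x, a, b, hx, h, rfl, rfl⟩

variable [Fintype E] [Fintype V]

noncomputable instance : Fintype S.Face := by
  classical
  exact Fintype.ofSurjective (Quot.mk _) Quot.mk_surjective

lemma card_face : Fintype.card E + 1 ≤ Fintype.card V + Fintype.card S.Face := by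
  classical
  have h1 := card_le_card_quot (N := Option (E × Bool)) (I := S.VPair) (fun i => up i.1.1) (fun i => dn i.1.2)
    S.rel (by
      rintro _ _ ⟨x, a, b, hx, hv, rfl, rfl⟩
      rcases S.vis_new hx hv with ⟨rfl, rfl⟩ | ⟨v, hv⟩
      · left; rfl
      · right; exact ⟨⟨(a, b), v, hv⟩, rfl, rfl⟩)
  have h2 := S.card_VPair
  simp only [Fintype.card_option, Fintype.card_prod, Fintype.card_bool] at h1
  have : Fintype.card (Quot S.rel) = Fintype.card S.Face := rfl
  omega

lemma exists_above {x : ℝ} {a : E ⊕ Bool} (ha : S.act a x) (ht : S.H a x < ⊤) : ∃ b, S.Vis x a b := by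
  classical
  have hne : ((Finset.univ : Finset (E ⊕ Bool)).filter (fun c => S.act c x ∧ S.H a x < S.H c x)).Nonempty :=
    ⟨Sum.inr true, Finset.mem_filter.2 ⟨Finset.mem_univ _, trivial, ht⟩⟩
  obtain ⟨b, hb, hm⟩ := Finset.exists_min_image _ (fun c => S.H c x) hne
  simp only [Finset.mem_filter, Finset.mem_univ, true_and] at hb hm
  refine ⟨b, ha, hb.1, hb.2, fun c hc => ?_⟩
  by_cases k : S.H c x ≤ S.H a x
  · exact Or.inl k
  · exact Or.inr (hm c ⟨hc, not_le.1 k⟩)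

lemma exists_below {x : ℝ} {a : E ⊕ Bool} (ha : S.act a x) (ht : ⊥ < S.H a x) : ∃ b, S.Vis x b a := by
  classical
  have hne : ((Finset.univ : Finset (E ⊕ Bool)).filter (fun c => S.act c x ∧ S.H c x < S.H a x)).Nonempty :=
    ⟨Sum.inr false, Finset.mem_filter.2 ⟨Finset.mem_univ _, trivial, ht⟩⟩
  obtain ⟨b, hb, hm⟩ := Finset.exists_max_image _ (fun c => S.H c x) hne
  simp only [Finset.mem_filter, Finset.mem_univ, true_and] at hb hm
  refine ⟨b, hb.1, ha, hb.2, fun c hc => ?_⟩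
  by_cases k : S.H a x ≤ S.H c x
  · exact Or.inr k
  · exact Or.inl (hm c ⟨hc, not_le.1 k⟩)

variable {q : S.Face}

lemma U_above (hq : q ≠ S.fc none) {x : ℝ} (hx : S.gen x) {e : E} (he : S.U q e) (ha : S.act (Sum.inl e) x) :
    ∃ f, S.D q f ∧ S.Vis x (Sum.inl e) (Sum.inl f) := by
  obtain ⟨b, hb⟩ := S.exists_above ha (by simp [H])
  have := S.fc_eq hx hb
  rcases b with f | b
  · exact ⟨f, by rw [← he]; exact this.symm, hb⟩
  · exact absurd (he.symm.trans this) hq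

lemma D_below (hq : q ≠ S.fc none) {x : ℝ} (hx : S.gen x) {e : E} (he : S.D q e) (ha : S.act (Sum.inl e) x) :
    ∃ f, S.U q f ∧ S.Vis x (Sum.inl f) (Sum.inl e) := by
  obtain ⟨b, hb⟩ := S.exists_below ha (by simp [H])
  have := S.fc_eq hx hb
  rcases b with f | b
  · exact ⟨f, by rw [← he]; exact this, hb⟩
  · exact absurd (he.symm.trans this.symm) hq

open Classical in
lemma balance (hq : q ≠ S.fc none) {x : ℝ} (hx : S.gen x) :
    (∑ e : E, if S.U q e ∧ S.act (Sum.inl e) x then (1 : ℤ) else 0) =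
    ∑ e : E, if S.D q e ∧ S.act (Sum.inl e) x then (1 : ℤ) else 0 := by
  rw [← Finset.sum_filter, ← Finset.sum_filter, Finset.sum_const, Finset.sum_const]
  congr 1
  apply le_antisymm
  · have : ∀ e : E, ∃ f : E, (S.U q e ∧ S.act (Sum.inl e) x) → (S.D q f ∧ S.Vis x (Sum.inl e) (Sum.inl f)) := by
      intro e
      by_cases h : S.U q e ∧ S.act (Sum.inl e) x
      · obtain ⟨f, hf⟩ := S.U_above hq hx h.1 h.2
        exact ⟨f, fun _ => hf⟩
      · exact ⟨e, fun k => absurd k h⟩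
    choose g hg using this
    refine Finset.card_le_card_of_injOn g ?_ ?_
    · intro e he
      simp only [Finset.coe_filter, Finset.mem_univ, true_and, Set.mem_ofPred_eq] at he ⊢
      exact ⟨(hg e he).1, (hg e he).2.2.1⟩
    · intro e he e' he' hee
      simp only [Finset.coe_filter, Finset.mem_univ, true_and, Set.mem_ofPred_eq] at he he'
      have h1 := (hg e he).2
      rw [hee] at h1
      exact Sum.inl_injective (S.vis_low_unique h1 (hg e' he').2)
  · have : ∀ e : E, ∃ f : E, (S.D q e ∧ S.act (Sum.inl e) x) → (S.U q f ∧ S.Vis x (Sum.inl f) (Sum.inl e)) := by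
      intro e
      by_cases h : S.D q e ∧ S.act (Sum.inl e) x
      · obtain ⟨f, hf⟩ := S.D_below hq hx h.1 h.2
        exact ⟨f, fun _ => hf⟩
      · exact ⟨e, fun k => absurd k h⟩
    choose g hg using this
    refine Finset.card_le_card_of_injOn g ?_ ?_
    · intro e he
      simp only [Finset.coe_filter, Finset.mem_univ, true_and, Set.mem_ofPred_eq] at he ⊢
      exact ⟨(hg e he).1, (hg e he).2.1⟩
    · intro e he e' he' hee
      simp only [Finset.coe_filter, Finset.mem_univ, true_and, Set.mem_ofPred_eq] at he he'
      have h1 := (hg e he).2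
      rw [hee] at h1
      exact Sum.inl_injective (S.vis_high_unique h1 (hg e' he').2)

def One (q : S.Face) (e : E) : Prop := ¬ (S.U q e ↔ S.D q e)

lemma one_other (hq : q ≠ S.fc none) {e : E} (he : S.One q e) {v : V} (hv : S.s e = v ∨ S.t e = v) :
    ∃ f, f ≠ e ∧ S.One q f ∧ (S.s f = v ∨ S.t f = v) := by
  classical
  by_contra hcon
  push Not at hcon
  have hR := S.balance hq (S.gen_R v)
  have hL := S.balance hq (S.gen_L v)
  have hsum : ∑ f : E, ((((if S.U q f ∧ S.act (Sum.inl f) (S.R v) then (1 : ℤ) else 0) -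
      (if S.D q f ∧ S.act (Sum.inl f) (S.R v) then (1 : ℤ) else 0)) -
      ((if S.U q f ∧ S.act (Sum.inl f) (S.L v) then (1 : ℤ) else 0) -
      (if S.D q f ∧ S.act (Sum.inl f) (S.L v) then (1 : ℤ) else 0)))) = 0 := by
    rw [Finset.sum_sub_distrib, Finset.sum_sub_distrib, Finset.sum_sub_distrib, hR, hL]
    simp
  have hlt := S.lt e
  rw [Finset.sum_eq_single e] at hsum
  · simp only [S.act_R, S.act_L] at hsum
    rcases hv with rfl | rfl
    · by_cases h1 : S.U q e <;> by_cases h2 : S.D q e <;> simp [One, h1, h2, hlt] at he hsum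
    · by_cases h1 : S.U q e <;> by_cases h2 : S.D q e <;> simp [One, h1, h2, hlt] at he hsum
  · intro f _ hfe
    by_cases hf : S.One q f
    · obtain ⟨h1, h2⟩ := hcon f hfe hf
      have h1' : S.X (S.s f) ≠ S.X v := fun k => h1 (S.xinj k)
      have h2' : S.X (S.t f) ≠ S.X v := fun k => h2 (S.xinj k)
      have : S.act (Sum.inl f) (S.R v) ↔ S.act (Sum.inl f) (S.L v) := by
        rw [S.act_R, S.act_L, le_iff_lt_or_eq, le_iff_lt_or_eq]
        simp [h1', Ne.symm h2']
      simp [this]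
    · simp only [One, not_not] at hf
      simp [hf]
  · simp

lemma exists_one (hq : q ≠ S.fc none) : ∃ e, S.One q e := by
  classical
  obtain ⟨m, hm⟩ := Quot.exists_rep q
  have : ∃ e, S.U q e ∨ S.D q e := by
    rcases m with _ | ⟨e, _ | _⟩
    · exact absurd hm.symm hq
    · exact ⟨e, Or.inr hm⟩
    · exact ⟨e, Or.inl hm⟩
  obtain ⟨e, he⟩ := this
  have hact : S.act (Sum.inl e) (S.R (S.s e)) := (S.act_R _ _).2 ⟨le_rfl, S.lt e⟩
  have hne : ((Finset.univ : Finset E).filter (fun c => (S.U q c ∨ S.D q c) ∧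
      S.act (Sum.inl c) (S.R (S.s e)))).Nonempty := ⟨e, by simp [he, hact]⟩
  obtain ⟨f, hf, hm⟩ := Finset.exists_min_image _ (fun c => S.h c (S.R (S.s e))) hne
  simp only [Finset.mem_filter, Finset.mem_univ, true_and] at hf hm
  have hD : ¬ S.D q f := by
    intro hD
    obtain ⟨g, hg1, hg2⟩ := S.D_below hq (S.gen_R _) hD hf.2
    have := hm g ⟨Or.inl hg1, hg2.1⟩
    have h3 := hg2.2.2.1
    simp only [H, EReal.coe_lt_coe_iff] at h3
    linarith
  refine ⟨f, ?_⟩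
  simp only [One, hD, iff_false, not_not]
  exact hf.1.resolve_right hD

lemma two_active (hq : q ≠ S.fc none) {x : ℝ} (hx : S.gen x) {e e' : E} (he : S.act (Sum.inl e) x) (hlt : S.h e x < S.h e' x)
    (hall : ∀ f, (S.U q f ∨ S.D q f) → S.act (Sum.inl f) x → f = e ∨ f = e') (hmem : S.U q e ∨ S.D q e) :
    S.U q e ∧ S.D q e' ∧ S.Vis x (Sum.inl e) (Sum.inl e') := by
  have hD : ¬ S.D q e := by
    intro hD
    obtain ⟨g, hg1, hg2⟩ := S.D_below hq hx hD he
    have h3 := hg2.2.2.1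
    simp only [H, EReal.coe_lt_coe_iff] at h3
    rcases hall g (Or.inl hg1) hg2.1 with rfl | rfl <;> linarith
  have hU := hmem.resolve_right hD
  obtain ⟨g, hg1, hg2⟩ := S.U_above hq hx hU he
  have h3 := hg2.2.2.1
  simp only [H, EReal.coe_lt_coe_iff] at h3
  rcases hall g (Or.inr hg1) hg2.2.1 with rfl | rfl
  · exact absurd h3 (lt_irrefl _)
  · exact ⟨hU, hg1, hg2⟩

lemma outer_two [Nonempty E] : ∃ e, S.U (S.fc none) e := by
  obtain ⟨e⟩ := ‹Nonempty E›
  have hact : S.act (Sum.inl e) (S.R (S.s e)) := (S.act_R _ _).2 ⟨le_rfl, S.lt e⟩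
  obtain ⟨b, hb⟩ := S.exists_below (x := S.R (S.s e)) (a := Sum.inr true) trivial (by simp [H])
  rcases b with f | b
  · exact ⟨f, S.fc_eq (S.gen_R _) hb⟩
  · exfalso
    rcases hb.2.2.2 _ hact with k | k
    · rcases b with _ | _
      · simp [H] at k
      · exact lt_irrefl _ hb.2.2.1
    · simp [H] at k

end SweepSys


/-- A straight-line drawing in generic position whose 4-cycles are parallelograms. -/
structure Drw {V : Type} (G : SimpleGraph V) where
  P : V → ℝ × ℝ
  xinj : Function.Injective (fun v => (P v).1)
  vtx : ∀ w a b, G.Adj a b → ∀ r : ℝ, 0 < r → r < 1 → P w ≠ P a + r • (P b - P a)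
  crs : ∀ a b c d, G.Adj a b → G.Adj c d → s(a, b) ≠ s(c, d) → ∀ r r' : ℝ, 0 < r → r < 1 →
    0 ≤ r' → r' ≤ 1 → P a + r • (P b - P a) ≠ P c + r' • (P d - P c)
  par : ∀ a b c d, G.Adj a b → G.Adj b c → G.Adj c d → G.Adj d a → a ≠ c → b ≠ d →
    P a + P c = P b + P d

/-- planar cross product -/
def cr (p q : ℝ × ℝ) : ℝ := p.1 * q.2 - p.2 * q.1

/-- interior of the parallelogram spanned at `a` by `b - a` and `d - a` -/
def InPar (a b d z : ℝ × ℝ) : Prop :=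
  0 < cr (b - a) (z - a) ∧ cr (b - a) (z - a) < cr (b - a) (d - a) ∧
  0 < cr (z - a) (d - a) ∧ cr (z - a) (d - a) < cr (b - a) (d - a)

namespace Drw

variable {V : Type} {G : SimpleGraph V} (Δ : Drw G)

/-- an empty parallelogram with counterclockwise corners `a b c d` -/
def Rh (a b c d : V) : Prop :=
  G.Adj a b ∧ G.Adj b c ∧ G.Adj c d ∧ G.Adj d a ∧ Δ.P a + Δ.P c = Δ.P b + Δ.P d ∧
  0 < cr (Δ.P b - Δ.P a) (Δ.P d - Δ.P a) ∧
  ∀ p q, G.Adj p q → ∀ r : ℝ, 0 ≤ r → r ≤ 1 →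
    ¬ InPar (Δ.P a) (Δ.P b) (Δ.P d) (Δ.P p + r • (Δ.P q - Δ.P p))

lemma inPar_rot {a b c d z : ℝ × ℝ} (h : a + c = b + d) : InPar b c a z ↔ InPar a b d z := by
  have hc : c = b + d - a := by rw [← h]; abel
  subst hc
  simp only [InPar, cr, Prod.fst_sub, Prod.snd_sub, Prod.fst_add, Prod.snd_add]
  constructor <;> rintro ⟨h1, h2, h3, h4⟩ <;> refine ⟨?_, ?_, ?_, ?_⟩ <;> nlinarith

lemma cr_rot {a b c d : ℝ × ℝ} (h : a + c = b + d) : cr (c - b) (a - b) = cr (b - a) (d - a) := by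
  have hc : c = b + d - a := by rw [← h]; abel
  subst hc
  simp only [cr, Prod.fst_sub, Prod.snd_sub, Prod.fst_add, Prod.snd_add]
  ring

lemma Rh.rot {Δ : Drw G} {a b c d : V} (h : Δ.Rh a b c d) : Δ.Rh b c d a := by
  obtain ⟨h1, h2, h3, h4, h5, h6, h7⟩ := h
  refine ⟨h2, h3, h4, h1, by rw [← h5, add_comm], by rwa [cr_rot h5], ?_⟩
  intro p q hpq r r0 r1
  rw [inPar_rot h5]
  exact h7 p q hpq r r0 r1

/-- edges oriented from left to right -/
abbrev Edg : Type := {p : V × V // G.Adj p.1 p.2 ∧ (Δ.P p.1).1 < (Δ.P p.2).1}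

/-- height over the abscissa `x` of the line through two points -/
noncomputable def ht (p q : ℝ × ℝ) (x : ℝ) : ℝ := p.2 + (x - p.1) * ((q.2 - p.2) / (q.1 - p.1))

lemma ht_eq {p q : ℝ × ℝ} (h : p.1 < q.1) (x : ℝ) :
    (x, ht p q x) = p + ((x - p.1) / (q.1 - p.1)) • (q - p) := by
  have : q.1 - p.1 ≠ 0 := by linarith
  ext
  · simp; field_simp; ring
  · simp [ht]; field_simp

lemma ratio {p q x : ℝ} (h1 : p < x) (h2 : x < q) : 0 < (x - p) / (q - p) ∧ (x - p) / (q - p) < 1 := by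
  have : 0 < q - p := by linarith
  refine ⟨div_pos (by linarith) this, ?_⟩
  rw [div_lt_one this]; linarith

/-- An edge is determined by its unordered pair of ends. -/
lemma edg_ext {e f : Δ.Edg} (h : s(e.1.1, e.1.2) = s(f.1.1, f.1.2)) : e = f := by
  obtain ⟨⟨a, b⟩, h1, h2⟩ := e
  obtain ⟨⟨c, d⟩, h3, h4⟩ := f
  simp only [Sym2.eq_iff] at h
  rcases h with ⟨rfl, rfl⟩ | ⟨rfl, rfl⟩
  · rfl
  · simp only at h2 h4
    exact absurd h2 (not_lt.2 h4.le)

/-- the sweep system of a drawing -/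
noncomputable def sys : SweepSys Δ.Edg V where
  s e := e.1.1
  t e := e.1.2
  X v := (Δ.P v).1
  Y v := (Δ.P v).2
  h e := ht (Δ.P e.1.1) (Δ.P e.1.2)
  xinj := Δ.xinj
  lt e := e.2.2
  hc e := by unfold ht; fun_prop
  hs e := by simp [ht]
  ht e := by
    have : (Δ.P e.1.2).1 - (Δ.P e.1.1).1 ≠ 0 := by linarith [e.2.2]
    simp only [ht]; field_simp; ring
  nv e v h1 h2 h3 := by
    obtain ⟨r0, r1⟩ := ratio h1 h2
    refine Δ.vtx v _ _ e.2.1 _ r0 r1 ?_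
    rw [← ht_eq e.2.2, h3]
  nc e f hef x h1 h2 h3 h4 h5 := by
    obtain ⟨r0, r1⟩ := ratio h1 h2
    obtain ⟨r0', r1'⟩ := ratio h3 h4
    refine Δ.crs _ _ _ _ e.2.1 f.2.1 (fun h => hef (Δ.edg_ext h)) _ _ r0 r1 r0'.le r1'.le ?_
    rw [← ht_eq e.2.2, ← ht_eq f.2.2, h5]

/-- dart with the given side on its left -/
def nd (m : Δ.Edg × Bool) : G.Dart :=
  if m.2 then ⟨(m.1.1.1, m.1.1.2), m.1.2.1⟩ else ⟨(m.1.1.2, m.1.1.1), m.1.2.1.symm⟩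

/-- a dart with an empty parallelogram on its left -/
def Rd (d : G.Dart) : Prop := ∃ c c', Δ.Rh d.fst d.snd c c'

variable [Fintype V]

noncomputable instance : Fintype Δ.Edg := by
  classical
  exact inferInstance

lemma perturb {a b d p q : ℝ × ℝ} {A : Set ℝ} (hA : A.Finite) (hpq : p.1 ≠ q.1) {r : ℝ} (r0 : 0 ≤ r) (r1 : r ≤ 1)
    (h : InPar a b d (p + r • (q - p))) :
    ∃ r' : ℝ, 0 < r' ∧ r' < 1 ∧ InPar a b d (p + r' • (q - p)) ∧ (p + r' • (q - p)).1 ∉ A := by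
  let O : Set ℝ := {r | InPar a b d (p + r • (q - p))}
  have hO : IsOpen O := by
    have : O = {r | 0 < cr (b - a) ((p + r • (q - p)) - a)} ∩ ({r | cr (b - a) ((p + r • (q - p)) - a) < cr (b - a) (d - a)} ∩
      ({r | 0 < cr ((p + r • (q - p)) - a) (d - a)} ∩ {r | cr ((p + r • (q - p)) - a) (d - a) < cr (b - a) (d - a)})) := by
      ext r; rfl
    rw [this]
    have c1 : Continuous (fun r : ℝ => cr (b - a) ((p + r • (q - p)) - a)) := by unfold cr; fun_prop
    have c2 : Continuous (fun r : ℝ => cr ((p + r • (q - p)) - a) (d - a)) := by unfold cr; fun_prop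
    exact (isOpen_lt continuous_const c1).inter ((isOpen_lt c1 continuous_const).inter
      ((isOpen_lt continuous_const c2).inter (isOpen_lt c2 continuous_const)))
  have hcl : r ∈ closure (Set.Ioo (0 : ℝ) 1) := by
    rw [closure_Ioo (by norm_num)]; exact ⟨r0, r1⟩
  obtain ⟨r2, hr2⟩ := mem_closure_iff.1 hcl O hO h
  have hinf : (O ∩ Set.Ioo (0 : ℝ) 1).Infinite :=
    infinite_of_mem_nhds r2 ((hO.inter isOpen_Ioo).mem_nhds hr2)
  have hfin : ((fun r : ℝ => (p + r • (q - p)).1) ⁻¹' A).Finite := by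
    apply hA.preimage
    intro x _ y _ hxy
    simp only [Prod.fst_add, Prod.smul_fst, Prod.fst_sub, smul_eq_mul, add_right_inj] at hxy
    exact mul_right_cancel₀ (sub_ne_zero.2 (Ne.symm hpq)) hxy
  obtain ⟨r', h1, h2⟩ := (hinf.sdiff hfin).nonempty
  exact ⟨r', h1.2.1, h1.2.2, h1.1, h2⟩

/-- The edges of the face `q` are those of the 4-cycle `a b c d`, each from one side. -/
def Cyc (q : Δ.sys.Face) (a b c d : V) : Prop :=
  G.Adj a b ∧ G.Adj b c ∧ G.Adj c d ∧ G.Adj d a ∧ a ≠ c ∧ b ≠ d ∧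
  (∀ e : Δ.Edg, (Δ.sys.U q e ∨ Δ.sys.D q e) → s(e.1.1, e.1.2) = s(a, b) ∨ s(e.1.1, e.1.2) = s(b, c) ∨
    s(e.1.1, e.1.2) = s(c, d) ∨ s(e.1.1, e.1.2) = s(d, a)) ∧
  (∀ e : Δ.Edg, (s(e.1.1, e.1.2) = s(a, b) ∨ s(e.1.1, e.1.2) = s(b, c) ∨
    s(e.1.1, e.1.2) = s(c, d) ∨ s(e.1.1, e.1.2) = s(d, a)) → Δ.sys.One q e)

lemma Cyc.rot {Δ : Drw G} {q : Δ.sys.Face} {a b c d : V} (h : Δ.Cyc q a b c d) : Δ.Cyc q b c d a := by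
  obtain ⟨h1, h2, h3, h4, h5, h6, h7, h8⟩ := h
  refine ⟨h2, h3, h4, h1, h6, h5.symm, fun e he => ?_, fun e he => h8 e ?_⟩
  · have := h7 e he; tauto
  · tauto

lemma Cyc.refl {Δ : Drw G} {q : Δ.sys.Face} {a b c d : V} (h : Δ.Cyc q a b c d) : Δ.Cyc q a d c b := by
  obtain ⟨h1, h2, h3, h4, h5, h6, h7, h8⟩ := h
  refine ⟨h4.symm, h3.symm, h2.symm, h1.symm, h5, h6.symm, fun e he => ?_, fun e he => h8 e ?_⟩
  · have := h7 e he
    rw [Sym2.eq_swap (a := a) (b := d), Sym2.eq_swap (a := d) (b := c), Sym2.eq_swap (a := c) (b := b),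
      Sym2.eq_swap (a := b) (b := a)]
    tauto
  · rw [Sym2.eq_swap (a := a) (b := d), Sym2.eq_swap (a := d) (b := c), Sym2.eq_swap (a := c) (b := b),
      Sym2.eq_swap (a := b) (b := a)] at he
    tauto

set_option maxHeartbeats 2000000 in
lemma core {q : Δ.sys.Face} (hq : q ≠ Δ.sys.fc none) {a b c d : V} (hC : Δ.Cyc q a b c d)
    (hab : (Δ.P a).1 < (Δ.P b).1) (had : (Δ.P a).1 < (Δ.P d).1)
    (hcr : 0 < cr (Δ.P b - Δ.P a) (Δ.P d - Δ.P a)) (m : Δ.Edg × Bool) (hm : Δ.sys.fc (some m) = q) :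
    Δ.Rd (Δ.nd m) := by
  obtain ⟨g1, g2, g3, g4, hac, hbd, hall, hone⟩ := hC
  have hpar := Δ.par a b c d g1 g2 g3 g4 hac hbd
  have px : (Δ.P a).1 + (Δ.P c).1 = (Δ.P b).1 + (Δ.P d).1 := congrArg Prod.fst hpar
  have py : (Δ.P a).2 + (Δ.P c).2 = (Δ.P b).2 + (Δ.P d).2 := congrArg Prod.snd hpar
  have hbc : (Δ.P b).1 < (Δ.P c).1 := by linarith
  have hdc : (Δ.P d).1 < (Δ.P c).1 := by linarith
  let eab : Δ.Edg := ⟨(a, b), g1, hab⟩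
  let ebc : Δ.Edg := ⟨(b, c), g2, hbc⟩
  let ead : Δ.Edg := ⟨(a, d), g4.symm, had⟩
  let edc : Δ.Edg := ⟨(d, c), g3.symm, hdc⟩
  have hall' : ∀ e, (Δ.sys.U q e ∨ Δ.sys.D q e) → e = eab ∨ e = ebc ∨ e = edc ∨ e = ead := by
    intro e he
    rcases hall e he with h | h | h | h
    · exact Or.inl (Δ.edg_ext h)
    · exact Or.inr (Or.inl (Δ.edg_ext h))
    · exact Or.inr (Or.inr (Or.inl (Δ.edg_ext (h.trans Sym2.eq_swap))))
    · exact Or.inr (Or.inr (Or.inr (Δ.edg_ext (h.trans Sym2.eq_swap))))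
  have o1 : Δ.sys.One q eab := hone _ (Or.inl rfl)
  have o2 : Δ.sys.One q ebc := hone _ (Or.inr (Or.inl rfl))
  have o3 : Δ.sys.One q edc := hone _ (Or.inr (Or.inr (Or.inl Sym2.eq_swap)))
  have o4 : Δ.sys.One q ead := hone _ (Or.inr (Or.inr (Or.inr Sym2.eq_swap)))
  have one_mem : ∀ e, Δ.sys.One q e → Δ.sys.U q e ∨ Δ.sys.D q e := by
    intro e he; unfold SweepSys.One at he; tauto
  -- slopes
  obtain ⟨μ, hμ⟩ : ∃ μ, μ = ((Δ.P b).2 - (Δ.P a).2) / ((Δ.P b).1 - (Δ.P a).1) := ⟨_, rfl⟩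
  obtain ⟨ν, hν⟩ : ∃ ν, ν = ((Δ.P d).2 - (Δ.P a).2) / ((Δ.P d).1 - (Δ.P a).1) := ⟨_, rfl⟩
  have yb : (Δ.P b).2 = (Δ.P a).2 + μ * ((Δ.P b).1 - (Δ.P a).1) := by
    have : (Δ.P b).1 - (Δ.P a).1 ≠ 0 := by linarith
    rw [hμ]; field_simp; ring
  have yd : (Δ.P d).2 = (Δ.P a).2 + ν * ((Δ.P d).1 - (Δ.P a).1) := by
    have : (Δ.P d).1 - (Δ.P a).1 ≠ 0 := by linarith
    rw [hν]; field_simp; ring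
  have k1 : 0 < (Δ.P b).1 - (Δ.P a).1 := by linarith
  have k2 : 0 < (Δ.P d).1 - (Δ.P a).1 := by linarith
  have hK : cr (Δ.P b - Δ.P a) (Δ.P d - Δ.P a) =
      ((Δ.P b).1 - (Δ.P a).1) * (((Δ.P d).1 - (Δ.P a).1) * (ν - μ)) := by
    simp only [cr, Prod.fst_sub, Prod.snd_sub, yb, yd]; ring
  have hμν : 0 < ν - μ := by
    rw [hK] at hcr
    exact pos_of_mul_pos_right (pos_of_mul_pos_right hcr k1.le) k2.le
  have hh1 : ∀ x, Δ.sys.h eab x = (Δ.P a).2 + (x - (Δ.P a).1) * μ := fun x => by rw [hμ]; rfl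
  have hh4 : ∀ x, Δ.sys.h ead x = (Δ.P a).2 + (x - (Δ.P a).1) * ν := fun x => by rw [hν]; rfl
  have hh2 : ∀ x, Δ.sys.h ebc x = (Δ.P b).2 + (x - (Δ.P b).1) * ν := fun x => by
    have e1 : (Δ.P c).2 - (Δ.P b).2 = (Δ.P d).2 - (Δ.P a).2 := by linarith
    have e2 : (Δ.P c).1 - (Δ.P b).1 = (Δ.P d).1 - (Δ.P a).1 := by linarith
    rw [hν, ← e1, ← e2]; rfl
  have hh3 : ∀ x, Δ.sys.h edc x = (Δ.P d).2 + (x - (Δ.P d).1) * μ := fun x => by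
    have e1 : (Δ.P c).2 - (Δ.P d).2 = (Δ.P b).2 - (Δ.P a).2 := by linarith
    have e2 : (Δ.P c).1 - (Δ.P d).1 = (Δ.P b).1 - (Δ.P a).1 := by linarith
    rw [hμ, ← e1, ← e2]; rfl
  -- visibility inside
  have vis : ∀ x, Δ.sys.gen x → (Δ.P a).1 < x → x < (Δ.P c).1 → ∃ lo hi,
      (lo = if x < (Δ.P b).1 then eab else ebc) ∧ (hi = if x < (Δ.P d).1 then ead else edc) ∧
      Δ.sys.U q lo ∧ Δ.sys.D q hi ∧ Δ.sys.Vis x (Sum.inl lo) (Sum.inl hi) := by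
    intro x hx xa xc
    have gb : x < (Δ.P b).1 ∨ (Δ.P b).1 < x := lt_or_gt_of_ne (hx b)
    have gd : x < (Δ.P d).1 ∨ (Δ.P d).1 < x := lt_or_gt_of_ne (hx d)
    refine ⟨_, _, rfl, rfl, ?_⟩
    rcases gb with gb | gb <;> rcases gd with gd | gd
    · rw [if_pos gb, if_pos gd]
      refine Δ.sys.two_active hq hx ⟨xa, gb⟩ ?_ ?_ (one_mem _ o1)
      · rw [hh1, hh4]; nlinarith
      · intro f hf hfa
        rcases hall' f hf with rfl | rfl | rfl | rfl
        · exact Or.inl rfl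
        · exact absurd hfa.1 (not_lt.2 gb.le)
        · exact absurd hfa.1 (not_lt.2 gd.le)
        · exact Or.inr rfl
    · rw [if_pos gb, if_neg gd.not_gt]
      refine Δ.sys.two_active hq hx ⟨xa, gb⟩ ?_ ?_ (one_mem _ o1)
      · rw [hh1, hh3, yd]; nlinarith
      · intro f hf hfa
        rcases hall' f hf with rfl | rfl | rfl | rfl
        · exact Or.inl rfl
        · exact absurd hfa.1 (not_lt.2 gb.le)
        · exact Or.inr rfl
        · exact absurd hfa.2 (not_lt.2 gd.le)
    · rw [if_neg gb.not_gt, if_pos gd]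
      refine Δ.sys.two_active hq hx ⟨gb, xc⟩ ?_ ?_ (one_mem _ o2)
      · rw [hh2, hh4, yb]; nlinarith
      · intro f hf hfa
        rcases hall' f hf with rfl | rfl | rfl | rfl
        · exact absurd hfa.2 (not_lt.2 gb.le)
        · exact Or.inl rfl
        · exact absurd hfa.1 (not_lt.2 gd.le)
        · exact Or.inr rfl
    · rw [if_neg gb.not_gt, if_neg gd.not_gt]
      refine Δ.sys.two_active hq hx ⟨gb, xc⟩ ?_ ?_ (one_mem _ o2)
      · rw [hh2, hh3, yb, yd]
        have : (Δ.P c).1 = (Δ.P b).1 + (Δ.P d).1 - (Δ.P a).1 := by linarith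
        rw [this] at xc
        nlinarith
      · intro f hf hfa
        rcases hall' f hf with rfl | rfl | rfl | rfl
        · exact absurd hfa.2 (not_lt.2 gb.le)
        · exact Or.inl rfl
        · exact Or.inr rfl
        · exact absurd hfa.2 (not_lt.2 gd.le)
  -- the parallelogram is empty
  have hRh : Δ.Rh a b c d := by
    refine ⟨g1, g2, g3, g4, hpar, hcr, ?_⟩
    have main : ∀ u v, G.Adj u v → (Δ.P u).1 < (Δ.P v).1 → ∀ r : ℝ, 0 ≤ r → r ≤ 1 →
        ¬ InPar (Δ.P a) (Δ.P b) (Δ.P d) (Δ.P u + r • (Δ.P v - Δ.P u)) := by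
      intro u v huv hlt r r0 r1 hin
      obtain ⟨r', s0, s1, hin', hgen⟩ := perturb (Set.finite_range (fun v => (Δ.P v).1)) hlt.ne r0 r1 hin
      clear hin r0 r1 r
      obtain ⟨z, hz⟩ : ∃ z, z = Δ.P u + r' • (Δ.P v - Δ.P u) := ⟨_, rfl⟩
      rw [← hz] at hin' hgen
      let f : Δ.Edg := ⟨(u, v), huv, hlt⟩
      have z1 : z.1 = (Δ.P u).1 + r' * ((Δ.P v).1 - (Δ.P u).1) := by rw [hz]; simp
      have z2 : z.2 = (Δ.P u).2 + r' * ((Δ.P v).2 - (Δ.P u).2) := by rw [hz]; simp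
      have hfz : Δ.sys.h f z.1 = z.2 := by
        change ht (Δ.P u) (Δ.P v) z.1 = z.2
        have : (Δ.P v).1 - (Δ.P u).1 ≠ 0 := by linarith
        rw [z1, z2, ht]; field_simp; ring
      have hfa : Δ.sys.act (Sum.inl f) z.1 := by
        constructor
        · change (Δ.P u).1 < z.1
          rw [z1]; nlinarith
        · change z.1 < (Δ.P v).1
          rw [z1]; nlinarith
      have hg : Δ.sys.gen z.1 := fun v hv => hgen ⟨v, hv.symm⟩
      obtain ⟨i1, i2, i3, i4⟩ := hin'
      rw [hK] at i2 i4
      have j1 : cr (Δ.P b - Δ.P a) (z - Δ.P a) = ((Δ.P b).1 - (Δ.P a).1) *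
          (z.2 - (Δ.P a).2 - (z.1 - (Δ.P a).1) * μ) := by
        simp only [cr, Prod.fst_sub, Prod.snd_sub, yb]; ring
      have j2 : cr (z - Δ.P a) (Δ.P d - Δ.P a) = ((Δ.P d).1 - (Δ.P a).1) *
          ((z.1 - (Δ.P a).1) * ν - (z.2 - (Δ.P a).2)) := by
        simp only [cr, Prod.fst_sub, Prod.snd_sub, yd]; ring
      rw [j1] at i1 i2
      rw [j2] at i3 i4
      have i1' := pos_of_mul_pos_right i1 k1.le
      have i3' := pos_of_mul_pos_right i3 k2.le
      have i2' := lt_of_mul_lt_mul_left i2 k1.le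
      have i4' : (z.1 - (Δ.P a).1) * ν - (z.2 - (Δ.P a).2) < ((Δ.P b).1 - (Δ.P a).1) * (ν - μ) := by
        refine lt_of_mul_lt_mul_left (a := (Δ.P d).1 - (Δ.P a).1) ?_ k2.le
        linarith [i4]
      have xa : (Δ.P a).1 < z.1 := by
        by_contra hcon
        push Not at hcon
        nlinarith
      have xc : z.1 < (Δ.P c).1 := by
        by_contra hcon
        push Not at hcon
        have : (Δ.P c).1 = (Δ.P b).1 + (Δ.P d).1 - (Δ.P a).1 := by linarith
        rw [this] at hcon
        nlinarith
      obtain ⟨lo, hi, hlo, hhi, -, -, hv⟩ := vis z.1 hg xa xc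
      have hlo' : Δ.sys.h lo z.1 < z.2 := by
        rw [hlo]
        split_ifs
        · rw [hh1]; linarith
        · rw [hh2, yb]; linarith
      have hhi' : z.2 < Δ.sys.h hi z.1 := by
        rw [hhi]
        split_ifs
        · rw [hh4]; linarith
        · rw [hh3, yd]; linarith
      rcases hv.2.2.2 _ hfa with k | k
      · simp only [SweepSys.H, EReal.coe_le_coe_iff] at k
        linarith
      · simp only [SweepSys.H, EReal.coe_le_coe_iff] at k
        linarith
    intro u v huv r r0 r1
    rcases lt_or_gt_of_ne (fun h => huv.ne (Δ.xinj h)) with h | h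
    · exact main u v huv h r r0 r1
    · have := main v u huv.symm h (1 - r) (by linarith) (by linarith)
      have e1 : Δ.P v + (1 - r) • (Δ.P u - Δ.P v) = Δ.P u + r • (Δ.P v - Δ.P u) := by module
      rwa [e1] at this
  -- sides
  have ra := Δ.sys.R_gt a
  have rb : Δ.sys.R a < (Δ.P b).1 := not_le.1 fun h => not_lt.2 (Δ.sys.R_spec a b h) hab
  have rd : Δ.sys.R a < (Δ.P d).1 := not_le.1 fun h => not_lt.2 (Δ.sys.R_spec a d h) had
  have lc := Δ.sys.L_lt c
  have lb : (Δ.P b).1 < Δ.sys.L c := not_le.1 fun h => not_lt.2 (Δ.sys.L_spec c b h) hbc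
  have ld : (Δ.P d).1 < Δ.sys.L c := not_le.1 fun h => not_lt.2 (Δ.sys.L_spec c d h) hdc
  obtain ⟨lo, hi, hlo, hhi, hU1, hD1, -⟩ := vis _ (Δ.sys.gen_R a) ra (by linarith)
  rw [if_pos rb] at hlo
  rw [if_pos rd] at hhi
  subst hlo hhi
  obtain ⟨lo, hi, hlo, hhi, hU2, hD2, -⟩ := vis _ (Δ.sys.gen_L c) (by linarith) lc
  rw [if_neg lb.not_gt] at hlo
  rw [if_neg ld.not_gt] at hhi
  subst hlo hhi
  obtain ⟨e, bb⟩ := m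
  have r1 := hRh.rot
  have r2 := r1.rot
  have r3 := r2.rot
  cases bb
  · have hD : Δ.sys.D q e := hm
    rcases hall' e (Or.inr hD) with rfl | rfl | rfl | rfl
    · exact absurd ⟨fun _ => hD, fun _ => hU1⟩ o1
    · exact absurd ⟨fun _ => hD, fun _ => hU2⟩ o2
    · exact ⟨_, _, r2⟩
    · exact ⟨_, _, r3⟩
  · have hU : Δ.sys.U q e := hm
    rcases hall' e (Or.inl hU) with rfl | rfl | rfl | rfl
    · exact ⟨_, _, hRh⟩
    · exact ⟨_, _, r1⟩
    · exact absurd ⟨fun _ => hD2, fun _ => hU⟩ o3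
    · exact absurd ⟨fun _ => hD1, fun _ => hU⟩ o4

end Drw


namespace Drw

variable {V : Type} {G : SimpleGraph V} (Δ : Drw G) [Fintype V]

lemma coreX {q : Δ.sys.Face} (hq : q ≠ Δ.sys.fc none) {a b c d : V} (hC : Δ.Cyc q a b c d)
    (hab : (Δ.P a).1 < (Δ.P b).1) (had : (Δ.P a).1 < (Δ.P d).1)
    (m : Δ.Edg × Bool) (hm : Δ.sys.fc (some m) = q) : Δ.Rd (Δ.nd m) := by
  rcases lt_trichotomy 0 (cr (Δ.P b - Δ.P a) (Δ.P d - Δ.P a)) with h | h | h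
  · exact Δ.core hq hC hab had h m hm
  · exfalso
    have ra := Δ.sys.R_gt a
    have rb : Δ.sys.R a < (Δ.P b).1 := not_le.1 fun h => not_lt.2 (Δ.sys.R_spec a b h) hab
    have rd : Δ.sys.R a < (Δ.P d).1 := not_le.1 fun h => not_lt.2 (Δ.sys.R_spec a d h) had
    let eab : Δ.Edg := ⟨(a, b), hC.1, hab⟩
    let ead : Δ.Edg := ⟨(a, d), hC.2.2.2.1.symm, had⟩
    have hne : eab ≠ ead := by
      intro h
      exact hC.2.2.2.2.2.1 (congrArg (fun e : Δ.Edg => e.1.2) h)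
    refine Δ.sys.nc eab ead hne (Δ.sys.R a) ra rb ra rd ?_
    change ht (Δ.P a) (Δ.P b) _ = ht (Δ.P a) (Δ.P d) _
    unfold ht
    have e1 : (Δ.P b).1 - (Δ.P a).1 ≠ 0 := by linarith
    have e2 : (Δ.P d).1 - (Δ.P a).1 ≠ 0 := by linarith
    congr 2
    rw [div_eq_div_iff e1 e2]
    simp only [cr, Prod.fst_sub, Prod.snd_sub] at h
    linarith
  · refine Δ.core hq hC.refl had hab ?_ m hm
    simp only [cr, Prod.fst_sub, Prod.snd_sub] at h ⊢
    linarith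

lemma core' {q : Δ.sys.Face} (hq : q ≠ Δ.sys.fc none) {a b c d : V} (hC : Δ.Cyc q a b c d)
    (m : Δ.Edg × Bool) (hm : Δ.sys.fc (some m) = q) : Δ.Rd (Δ.nd m) := by
  have n1 := lt_or_gt_of_ne (fun h => hC.1.ne (Δ.xinj h))
  have n2 := lt_or_gt_of_ne (fun h => hC.2.1.ne (Δ.xinj h))
  have n3 := lt_or_gt_of_ne (fun h => hC.2.2.1.ne (Δ.xinj h))
  have n4 := lt_or_gt_of_ne (fun h => hC.2.2.2.1.ne (Δ.xinj h))
  rcases n1 with n1 | n1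
  · rcases n4 with n4 | n4
    · rcases n3 with n3 | n3
      · rcases n2 with n2 | n2
        · linarith
        · exact Δ.coreX hq hC.rot.rot n3 n2 m hm
      · exact Δ.coreX hq hC.rot.rot.rot n4 n3 m hm
    · exact Δ.coreX hq hC n1 n4 m hm
  · rcases n2 with n2 | n2
    · exact Δ.coreX hq hC.rot n2 n1 m hm
    · rcases n3 with n3 | n3
      · exact Δ.coreX hq hC.rot.rot n3 n2 m hm
      · rcases n4 with n4 | n4
        · exact Δ.coreX hq hC.rot.rot.rot n4 n3 m hm
        · linarith

/-- adjacency by a one-sided edge of the face `q` -/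
def OA (q : Δ.sys.Face) (x y : V) : Prop := ∃ e : Δ.Edg, Δ.sys.One q e ∧ s(e.1.1, e.1.2) = s(x, y)

lemma OA.symm {Δ : Drw G} {q : Δ.sys.Face} {x y : V} (h : Δ.OA q x y) : Δ.OA q y x := by
  obtain ⟨e, h1, h2⟩ := h
  exact ⟨e, h1, h2.trans Sym2.eq_swap⟩

lemma OA.adj {Δ : Drw G} {q : Δ.sys.Face} {x y : V} (h : Δ.OA q x y) : G.Adj x y := by
  obtain ⟨e, -, h2⟩ := h
  have := e.2.1
  rwa [← SimpleGraph.mem_edgeSet, h2, SimpleGraph.mem_edgeSet] at this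

lemma OA.one {Δ : Drw G} {q : Δ.sys.Face} {x y : V} (h : Δ.OA q x y) {e : Δ.Edg}
    (he : s(e.1.1, e.1.2) = s(x, y)) : Δ.sys.One q e := by
  obtain ⟨f, h1, h2⟩ := h
  rwa [Δ.edg_ext (he.trans h2.symm)]

lemma OA.next {Δ : Drw G} {q : Δ.sys.Face} (hq : q ≠ Δ.sys.fc none) {a b : V} (h : Δ.OA q a b) :
    ∃ c, c ≠ a ∧ Δ.OA q b c := by
  obtain ⟨e, h1, h2⟩ := h
  have hv : Δ.sys.s e = b ∨ Δ.sys.t e = b := by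
    rcases Sym2.eq_iff.1 h2 with ⟨-, h⟩ | ⟨h, -⟩
    · exact Or.inr h
    · exact Or.inl h
  obtain ⟨f, hf, hf1, hf2⟩ := Δ.sys.one_other hq h1 hv
  rcases hf2 with k | k
  · have k' : f.1.1 = b := k
    have e1 : s(f.1.1, f.1.2) = s(b, f.1.2) := by rw [k']
    refine ⟨f.1.2, fun hc => hf (Δ.edg_ext ?_), f, hf1, e1⟩
    rw [h2, e1, hc, Sym2.eq_swap]
  · have k' : f.1.2 = b := k
    have e1 : s(f.1.1, f.1.2) = s(b, f.1.1) := by rw [k', Sym2.eq_swap]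
    refine ⟨f.1.1, fun hc => hf (Δ.edg_ext ?_), f, hf1, e1⟩
    rw [h2, e1, hc, Sym2.eq_swap]

open Classical in
/-- nodes of a face -/
noncomputable def F (q : Δ.sys.Face) : Finset (Δ.Edg × Bool) :=
  Finset.univ.filter (fun m => Δ.sys.fc (some m) = q)

lemma face4 (htf : G.CliqueFree 3) {q : Δ.sys.Face} (hq : q ≠ Δ.sys.fc none) (hc : (Δ.F q).card ≤ 4) :
    4 ≤ (Δ.F q).card ∧ ∃ a b c d, Δ.Cyc q a b c d := by
  classical
  have tri : ∀ x y z, G.Adj x y → G.Adj y z → G.Adj x z → False := by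
    intro x y z h1 h2 h3
    exact htf {x, y, z} (SimpleGraph.is3Clique_iff.2 ⟨x, y, z, h1, h3, h2, rfl⟩)
  obtain ⟨W, hW⟩ : ∃ W : Finset (Sym2 V), W = (Δ.F q).image (fun m => s(m.1.1.1, m.1.1.2)) := ⟨_, rfl⟩
  have hWc : W.card ≤ (Δ.F q).card := by rw [hW]; exact Finset.card_image_le
  have hWm : ∀ e : Δ.Edg, (Δ.sys.U q e ∨ Δ.sys.D q e) → s(e.1.1, e.1.2) ∈ W := by
    intro e he
    rw [hW, Finset.mem_image]
    rcases he with h | h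
    · exact ⟨(e, true), by simp only [F, Finset.mem_filter, Finset.mem_univ, true_and]; exact h, rfl⟩
    · exact ⟨(e, false), by simp only [F, Finset.mem_filter, Finset.mem_univ, true_and]; exact h, rfl⟩
  have hOA : ∀ x y, Δ.OA q x y → s(x, y) ∈ W := by
    rintro x y ⟨e, h1, h2⟩
    rw [← h2]
    apply hWm
    unfold SweepSys.One at h1
    tauto
  obtain ⟨e, he⟩ := Δ.sys.exists_one hq
  obtain ⟨a, b, hab⟩ : ∃ a b, Δ.OA q a b := ⟨_, _, e, he, rfl⟩
  obtain ⟨c, hca, hbc⟩ := hab.next hq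
  obtain ⟨d, hdb, had⟩ := hab.symm.next hq
  have hcd : c ≠ d := by
    rintro rfl
    exact tri a b c hab.adj hbc.adj had.adj
  obtain ⟨f, hfb, hcf⟩ := hbc.next hq
  obtain ⟨g, hga, hdg⟩ := had.next hq
  have ab := hab.adj.ne
  have bc := hbc.adj.ne
  have ad := had.adj.ne
  by_cases hfd : f = d
  · subst hfd
    have hsub : ({s(a, b), s(b, c), s(c, f), s(f, a)} : Finset (Sym2 V)) ⊆ W := by
      intro x hx
      simp only [Finset.mem_insert, Finset.mem_singleton] at hx
      rcases hx with rfl | rfl | rfl | rfl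
      · exact hOA _ _ hab
      · exact hOA _ _ hbc
      · exact hOA _ _ hcf
      · exact hOA _ _ had.symm
    have hcard : ({s(a, b), s(b, c), s(c, f), s(f, a)} : Finset (Sym2 V)).card = 4 := by
      repeat rw [Finset.card_insert_of_notMem]
      · simp
      all_goals
        simp only [Finset.mem_insert, Finset.mem_singleton, Sym2.eq_iff]
        grind
    have h4 : 4 ≤ W.card := hcard ▸ Finset.card_le_card hsub
    have hWe := Finset.eq_of_subset_of_card_le hsub (by omega)
    refine ⟨by omega, a, b, c, f, hab.adj, hbc.adj, hcf.adj, had.adj.symm, hca.symm, hdb.symm, ?_, ?_⟩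
    · intro e he
      have := hWm e he
      rw [← hWe] at this
      simpa only [Finset.mem_insert, Finset.mem_singleton] using this
    · intro e he
      rcases he with h | h | h | h
      · exact hab.one h
      · exact hbc.one h
      · exact hcf.one h
      · exact had.symm.one h
  · exfalso
    have hsub : ({s(a, b), s(b, c), s(a, d), s(c, f), s(d, g)} : Finset (Sym2 V)) ⊆ W := by
      intro x hx
      simp only [Finset.mem_insert, Finset.mem_singleton] at hx
      rcases hx with rfl | rfl | rfl | rfl | rfl
      · exact hOA _ _ hab
      · exact hOA _ _ hbc
      · exact hOA _ _ had
      · exact hOA _ _ hcf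
      · exact hOA _ _ hdg
    have hcard : ({s(a, b), s(b, c), s(a, d), s(c, f), s(d, g)} : Finset (Sym2 V)).card = 5 := by
      repeat rw [Finset.card_insert_of_notMem]
      · simp
      all_goals
        simp only [Finset.mem_insert, Finset.mem_singleton, Sym2.eq_iff]
        grind
    have h4 : 5 ≤ W.card := hcard ▸ Finset.card_le_card hsub
    omega

lemma nd_edge (m : Δ.Edg × Bool) : s((Δ.nd m).fst, (Δ.nd m).snd) = s(m.1.1.1, m.1.1.2) := by
  obtain ⟨e, b⟩ := m
  cases b
  · exact Sym2.eq_swap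
  · rfl

lemma nd_bij : Function.Bijective Δ.nd := by
  constructor
  · intro m m' h
    have h1 : m.1 = m'.1 := Δ.edg_ext (by rw [← nd_edge, ← nd_edge, h])
    obtain ⟨e, b⟩ := m
    obtain ⟨e', b'⟩ := m'
    simp only at h1
    subst h1
    have h2 := congrArg (fun d : G.Dart => d.fst) h
    have := e.2.1.ne
    cases b <;> cases b' <;> simp [nd] at h2 ⊢
    · exact this h2.symm
    · exact this h2
  · intro d
    rcases lt_or_gt_of_ne (fun h => d.adj.ne (Δ.xinj h)) with h | h
    · exact ⟨(⟨(d.fst, d.snd), d.adj, h⟩, true), rfl⟩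
    · exact ⟨(⟨(d.snd, d.fst), d.adj.symm, h⟩, false), rfl⟩

lemma card_edg : Nat.card G.Dart = 2 * Fintype.card Δ.Edg := by
  rw [← Nat.card_congr (Equiv.ofBijective _ Δ.nd_bij), Nat.card_eq_fintype_card, Fintype.card_prod,
    Fintype.card_bool, mul_comm]

open Classical in
theorem partA (htf : G.CliqueFree 3) [Nonempty G.Dart] :
    6 * Nat.card G.Dart + 4 ≤ 20 * Fintype.card V + Nat.card {d // Δ.Rd d} := by
  have hE : Nonempty Δ.Edg := by
    obtain ⟨d⟩ := ‹Nonempty G.Dart›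
    obtain ⟨m, -⟩ := Δ.nd_bij.2 d
    exact ⟨m.1⟩
  have hρ : Nat.card {d // Δ.Rd d} = (Finset.univ.filter (fun m : Δ.Edg × Bool => Δ.Rd (Δ.nd m))).card := by
    rw [← Fintype.card_subtype, ← Nat.card_eq_fintype_card]
    refine (Nat.card_congr ?_).symm
    exact (Equiv.ofBijective _ Δ.nd_bij).subtypeEquiv (fun m => Iff.rfl)
  have hq : ∀ q : Δ.sys.Face, 20 ≤ 4 * (Δ.F q).card + ((Finset.univ.filter (fun m : Δ.Edg × Bool => Δ.Rd (Δ.nd m))).filter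
      (fun m => Δ.sys.fc (some m) = q)).card + (if q = Δ.sys.fc none then 16 else 0) := by
    intro q
    by_cases h0 : q = Δ.sys.fc none
    · rw [if_pos h0]
      obtain ⟨e, he⟩ := Δ.sys.outer_two
      have : 0 < (Δ.F q).card := Finset.card_pos.2 ⟨(e, true), by
        simp only [F, Finset.mem_filter, Finset.mem_univ, true_and]
        rw [h0]; exact he⟩
      omega
    · rw [if_neg h0]
      by_cases h4 : (Δ.F q).card ≤ 4
      · obtain ⟨k, a, b, c, d, hC⟩ := Δ.face4 htf h0 h4
        have : Δ.F q ⊆ ((Finset.univ.filter (fun m : Δ.Edg × Bool => Δ.Rd (Δ.nd m))).filter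
            (fun m => Δ.sys.fc (some m) = q)) := by
          intro m hm
          simp only [F, Finset.mem_filter, Finset.mem_univ, true_and] at hm ⊢
          exact ⟨Δ.core' h0 hC m hm, hm⟩
        have := Finset.card_le_card this
        omega
      · omega
  have hs := Finset.sum_le_sum (fun q (_ : q ∈ Finset.univ) => hq q)
  rw [Finset.sum_add_distrib, Finset.sum_add_distrib, ← Finset.mul_sum, Finset.sum_ite_eq' ] at hs
  have s1 : ∑ q, (Δ.F q).card = Fintype.card (Δ.Edg × Bool) :=
    (Finset.card_eq_sum_card_fiberwise (f := fun m : Δ.Edg × Bool => Δ.sys.fc (some m))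
      (s := Finset.univ) (t := Finset.univ) (by intro _ _; simp)).symm
  have s2 := (Finset.card_eq_sum_card_fiberwise (f := fun m : Δ.Edg × Bool => Δ.sys.fc (some m))
      (s := (Finset.univ.filter (fun m : Δ.Edg × Bool => Δ.Rd (Δ.nd m)))) (t := Finset.univ) (by intro _ _; simp)).symm
  rw [s1, s2, ← hρ] at hs
  have hcf := Δ.sys.card_face
  have := Δ.card_edg
  rw [Fintype.card_prod, Fintype.card_bool] at hs
  simp only [Finset.sum_const, Finset.card_univ, smul_eq_mul, Finset.mem_univ, if_true] at hs
  omega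

end Drw


lemma cr_sub_right (u v w : ℝ × ℝ) : cr u (v - w) = cr u v - cr u w := by
  simp only [cr, Prod.fst_sub, Prod.snd_sub]; ring

lemma cr_add_right (u v w : ℝ × ℝ) : cr u (v + w) = cr u v + cr u w := by
  simp only [cr, Prod.fst_add, Prod.snd_add]; ring

lemma cr_smul_right (u v : ℝ × ℝ) (r : ℝ) : cr u (r • v) = r * cr u v := by
  simp only [cr, Prod.smul_fst, Prod.smul_snd, smul_eq_mul]; ring

lemma cr_self (u : ℝ × ℝ) : cr u u = 0 := by
  simp only [cr]; ring

lemma cr_anti (u v : ℝ × ℝ) : cr u v = - cr v u := by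
  simp only [cr]; ring

/-- decomposition of a point in the frame of a parallelogram -/
lemma par_decomp {u w z : ℝ × ℝ} (h : cr u w ≠ 0) :
    z = (cr z w / cr u w) • u + (cr u z / cr u w) • w := by
  ext
  · simp only [Prod.fst_add, Prod.smul_fst, smul_eq_mul]
    field_simp
    simp only [cr]; ring
  · simp only [Prod.snd_add, Prod.smul_snd, smul_eq_mul]
    field_simp
    simp only [cr]; ring

lemma cr_ext {u w z z' : ℝ × ℝ} (h : cr u w ≠ 0) (h1 : cr u z = cr u z') (h2 : cr w z = cr w z') : z = z' := by
  rw [par_decomp (z := z) h, par_decomp (z := z') h, h1, cr_anti z w, cr_anti z' w, h2]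

namespace Drw

variable {V : Type} {G : SimpleGraph V} (Δ : Drw G)

lemma pinj {a b : V} (h : Δ.P a = Δ.P b) : a = b := Δ.xinj (congrArg Prod.fst h)

lemma Rh.fwd {Δ : Drw G} {a b c d : V} (h : Δ.Rh a b c d) : Δ.P c - Δ.P d = Δ.P b - Δ.P a := by
  have := h.2.2.2.2.1
  rw [sub_eq_sub_iff_add_eq_add, add_comm, this]

lemma bdry {a b c d : V} (h : Δ.Rh a b c d) {z : ℝ × ℝ}
    (h1 : 0 ≤ cr (Δ.P b - Δ.P a) (z - Δ.P a))
    (h2 : cr (Δ.P b - Δ.P a) (z - Δ.P a) ≤ cr (Δ.P b - Δ.P a) (Δ.P d - Δ.P a))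
    (h3 : 0 ≤ cr (z - Δ.P a) (Δ.P d - Δ.P a))
    (h4 : cr (z - Δ.P a) (Δ.P d - Δ.P a) ≤ cr (Δ.P b - Δ.P a) (Δ.P d - Δ.P a))
    (hn : ¬ InPar (Δ.P a) (Δ.P b) (Δ.P d) z) :
    ∃ p q, G.Adj p q ∧ (p = a ∨ p = b ∨ p = c ∨ p = d) ∧ (q = a ∨ q = b ∨ q = c ∨ q = d) ∧
      ∃ r : ℝ, 0 ≤ r ∧ r ≤ 1 ∧ z = Δ.P p + r • (Δ.P q - Δ.P p) := by
  obtain ⟨g1, g2, g3, g4, hp, hK, -⟩ := h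
  have hc : Δ.P c = Δ.P b + Δ.P d - Δ.P a := by rw [← hp]; abel
  have hd := par_decomp (z := z - Δ.P a) hK.ne'
  have hz : z = Δ.P a + (z - Δ.P a) := by abel
  set K := cr (Δ.P b - Δ.P a) (Δ.P d - Δ.P a)
  set x := cr (Δ.P b - Δ.P a) (z - Δ.P a)
  set y := cr (z - Δ.P a) (Δ.P d - Δ.P a)
  have x0 : 0 ≤ x / K := div_nonneg h1 hK.le
  have y0 : 0 ≤ y / K := div_nonneg h3 hK.le
  have x1 : x / K ≤ 1 := (div_le_one hK).2 h2
  have y1 : y / K ≤ 1 := (div_le_one hK).2 h4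
  rw [hd] at hz
  rcases h1.eq_or_lt with e1 | e1
  · refine ⟨a, b, g1, by tauto, by tauto, _, y0, y1, ?_⟩
    rw [hz, ← e1]; module
  rcases h2.eq_or_lt with e2 | e2
  · refine ⟨d, c, g3.symm, by tauto, by tauto, _, y0, y1, ?_⟩
    rw [hz, e2, hc, div_self hK.ne']; module
  rcases h3.eq_or_lt with e3 | e3
  · refine ⟨a, d, g4.symm, by tauto, by tauto, _, x0, x1, ?_⟩
    rw [hz, ← e3]; module
  rcases h4.eq_or_lt with e4 | e4
  · refine ⟨b, c, g2, by tauto, by tauto, _, x0, x1, ?_⟩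
    rw [hz, e4, hc, div_self hK.ne']; module
  exact absurd ⟨e1, e2, e3, e4⟩ hn

/-- A corner of an empty parallelogram that meets another one is a corner of the latter. -/
lemma corner {a b c d a' b' c' d' : V} (h : Δ.Rh a b c d) (h' : Δ.Rh a' b' c' d') {z : ℝ × ℝ}
    (hz : InPar (Δ.P a) (Δ.P b) (Δ.P d) z) (hz' : InPar (Δ.P a') (Δ.P b') (Δ.P d') z) :
    a = a' ∨ a = b' ∨ a = c' ∨ a = d' := by
  let w : ℝ → ℝ × ℝ := fun r => z + r • (Δ.P a - z)
  have w0 : w 0 = z := by simp [w]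
  have w1 : w 1 = Δ.P a := by simp [w]
  have hin : ∀ r : ℝ, 0 ≤ r → r < 1 → InPar (Δ.P a) (Δ.P b) (Δ.P d) (w r) := by
    intro r r0 r1
    obtain ⟨i1, i2, i3, i4⟩ := hz
    have e1 : cr (Δ.P b - Δ.P a) (w r - Δ.P a) = (1 - r) * cr (Δ.P b - Δ.P a) (z - Δ.P a) := by
      simp only [w, cr, Prod.fst_sub, Prod.snd_sub, Prod.fst_add, Prod.snd_add, Prod.smul_fst, Prod.smul_snd,
        smul_eq_mul]; ring
    have e2 : cr (w r - Δ.P a) (Δ.P d - Δ.P a) = (1 - r) * cr (z - Δ.P a) (Δ.P d - Δ.P a) := by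
      simp only [w, cr, Prod.fst_sub, Prod.snd_sub, Prod.fst_add, Prod.snd_add, Prod.smul_fst, Prod.smul_snd,
        smul_eq_mul]; ring
    have : 0 < 1 - r := by linarith
    refine ⟨?_, ?_, ?_, ?_⟩
    · rw [e1]; positivity
    · rw [e1]; nlinarith
    · rw [e2]; positivity
    · rw [e2]; nlinarith
  let m : ℝ → ℝ := fun r => min (min (cr (Δ.P b' - Δ.P a') (w r - Δ.P a'))
    (cr (Δ.P b' - Δ.P a') (Δ.P d' - Δ.P a') - cr (Δ.P b' - Δ.P a') (w r - Δ.P a')))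
    (min (cr (w r - Δ.P a') (Δ.P d' - Δ.P a'))
    (cr (Δ.P b' - Δ.P a') (Δ.P d' - Δ.P a') - cr (w r - Δ.P a') (Δ.P d' - Δ.P a')))
  have hm : Continuous m := by simp only [m, w, cr]; fun_prop
  have mpos : ∀ r, 0 < m r ↔ InPar (Δ.P a') (Δ.P b') (Δ.P d') (w r) := by
    intro r
    simp only [m, lt_min_iff, InPar, sub_pos]
    tauto
  have mb : ∀ r, m r = 0 → ∃ p q, G.Adj p q ∧ (p = a' ∨ p = b' ∨ p = c' ∨ p = d') ∧
      (q = a' ∨ q = b' ∨ q = c' ∨ q = d') ∧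
      ∃ s : ℝ, 0 ≤ s ∧ s ≤ 1 ∧ w r = Δ.P p + s • (Δ.P q - Δ.P p) := by
    intro r hr
    have h0 : 0 ≤ m r := hr.ge
    simp only [m, le_min_iff, sub_nonneg] at h0
    obtain ⟨⟨k1, k2⟩, k3, k4⟩ := h0
    refine Δ.bdry h' k1 k2 k3 k4 (fun hcon => ?_)
    have := (mpos r).2 hcon
    linarith
  have m0 : 0 < m 0 := by rw [mpos, w0]; exact hz'
  rcases lt_trichotomy (m 1) 0 with h1 | h1 | h1
  · exfalso
    have := intermediate_value_Icc' (zero_le_one' ℝ) hm.continuousOn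
    obtain ⟨r, hr, hr0⟩ := this ⟨h1.le, m0.le⟩
    have hr1 : r < 1 := by
      refine lt_of_le_of_ne hr.2 ?_
      rintro rfl
      linarith
    obtain ⟨p, q, hpq, -, -, s, s0, s1, hs⟩ := mb r hr0
    apply h.2.2.2.2.2.2 p q hpq s s0 s1
    rw [← hs]
    exact hin r hr.1 hr1
  · obtain ⟨p, q, hpq, hp, hq, s, s0, s1, hs⟩ := mb 1 h1
    rw [w1] at hs
    rcases s0.eq_or_lt with e | e
    · rw [← e, zero_smul, add_zero] at hs
      rw [Δ.pinj hs]; exact hp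
    rcases s1.eq_or_lt with e' | e'
    · rw [e', one_smul, add_sub_cancel] at hs
      rw [Δ.pinj hs]; exact hq
    exact absurd hs (Δ.vtx a p q hpq s e e')
  · exfalso
    rw [mpos, w1] at h1
    refine h'.2.2.2.2.2.2 a b h.1 0 le_rfl zero_le_one ?_
    rwa [zero_smul, add_zero]

lemma Rh.ne {Δ : Drw G} {a b c d : V} (h : Δ.Rh a b c d) : a ≠ c ∧ b ≠ d := by
  constructor
  · rintro rfl
    have h5 := h.2.2.2.2.1
    have h6 := h.2.2.2.2.2.1
    have e1 := congrArg Prod.fst h5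
    have e2 := congrArg Prod.snd h5
    simp only [Prod.fst_add, Prod.snd_add] at e1 e2
    have : cr (Δ.P b - Δ.P a) (Δ.P d - Δ.P a) = 0 := by
      have e1' : (Δ.P d).1 - (Δ.P a).1 = -((Δ.P b).1 - (Δ.P a).1) := by linarith
      have e2' : (Δ.P d).2 - (Δ.P a).2 = -((Δ.P b).2 - (Δ.P a).2) := by linarith
      simp only [cr, Prod.fst_sub, Prod.snd_sub, e1', e2']; ring
    linarith
  · rintro rfl
    have h6 := h.2.2.2.2.2.1
    rw [cr_self] at h6
    exact lt_irrefl _ h6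

lemma same {a b c d b' c' d' : V} (h : Δ.Rh a b c d) (h' : Δ.Rh a b' c' d') {z : ℝ × ℝ}
    (hz : InPar (Δ.P a) (Δ.P b) (Δ.P d) z) (hz' : InPar (Δ.P a) (Δ.P b') (Δ.P d') z) :
    b = b' ∧ c = c' ∧ d = d' := by
  have z1 := (inPar_rot h'.2.2.2.2.1).2 hz'
  have z2 := (inPar_rot h'.rot.2.2.2.2.1).2 z1
  have z3 := (inPar_rot h'.rot.rot.2.2.2.2.1).2 z2
  have c1 := Δ.corner h'.rot h z1 hz
  have c2 := Δ.corner h'.rot.rot h z2 hz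
  have c3 := Δ.corner h'.rot.rot.rot h z3 hz
  have n1 := h'.1.ne
  have n2 := h'.2.1.ne
  have n3 := h'.2.2.1.ne
  have n4 := h'.2.2.2.1.ne
  have n5 := h'.ne
  have p := h.2.2.2.2.1
  have p' := h'.2.2.2.2.1
  have k := h.2.2.2.2.2.1
  have k' := h'.2.2.2.2.2.1
  have e1 := congrArg Prod.fst p
  have e2 := congrArg Prod.snd p
  have e1' := congrArg Prod.fst p'
  have e2' := congrArg Prod.snd p'
  simp only [cr, Prod.fst_add, Prod.snd_add, Prod.fst_sub, Prod.snd_sub] at e1 e2 e1' e2' k k'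
  rcases c1 with rfl | rfl | rfl | rfl
  · exact absurd rfl n1
  · rcases c2 with rfl | rfl | rfl | rfl
    · exact absurd rfl n5.1
    · exact absurd rfl n2
    · rcases c3 with rfl | rfl | rfl | rfl
      · exact absurd rfl n4
      · exact absurd rfl n5.2
      · exact absurd rfl n3
      · exact ⟨rfl, rfl, rfl⟩
    · rcases c3 with rfl | rfl | rfl | rfl
      · exact absurd rfl n4
      · exact absurd rfl n5.2
      · exfalso
        have f1 : (Δ.P b').1 - (Δ.P a).1 = 0 := by linarith
        have f2 : (Δ.P b').2 - (Δ.P a).2 = 0 := by linarith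
        rw [f1, f2] at k
        linarith
      · exact absurd rfl n3
  · rcases c2 with rfl | rfl | rfl | rfl
    · exact absurd rfl n5.1
    · rcases c3 with rfl | rfl | rfl | rfl
      · exact absurd rfl n4
      · exact absurd rfl n3
      · exact absurd rfl n5.2
      · exfalso
        have f1 : (Δ.P d').1 - (Δ.P a).1 = 0 := by linarith
        have f2 : (Δ.P d').2 - (Δ.P a).2 = 0 := by linarith
        rw [f1, f2] at k
        linarith
    · exact absurd rfl n2
    · rcases c3 with rfl | rfl | rfl | rfl
      · exact absurd rfl n4
      · exfalso
        have f1 : (Δ.P d').1 - (Δ.P a).1 = 0 := by linarith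
        have f2 : (Δ.P d').2 - (Δ.P a).2 = 0 := by linarith
        rw [f1, f2] at k
        linarith
      · exact absurd rfl n5.2
      · exact absurd rfl n3
  · rcases c2 with rfl | rfl | rfl | rfl
    · exact absurd rfl n5.1
    · rcases c3 with rfl | rfl | rfl | rfl
      · exact absurd rfl n4
      · exact absurd rfl n3
      · exfalso
        have f1 : (Δ.P b').1 - (Δ.P a).1 = 0 := by linarith
        have f2 : (Δ.P b').2 - (Δ.P a).2 = 0 := by linarith
        rw [f1, f2] at k'
        linarith
      · exact absurd rfl n5.2
    · rcases c3 with rfl | rfl | rfl | rfl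
      · exact absurd rfl n4
      · exfalso; linarith
      · exact absurd rfl n3
      · exact absurd rfl n5.2
    · exact absurd rfl n2

/-- points of the mid-ribbon of a parallelogram are interior -/
lemma inPar_rib {a b d : ℝ × ℝ} (hK : 0 < cr (b - a) (d - a)) {τ : ℝ} (h0 : 0 < τ) (h1 : τ < 1) :
    InPar a b d (a + (1 / 2 : ℝ) • (b - a) + τ • (d - a)) := by
  have e1 : cr (b - a) (a + (1 / 2 : ℝ) • (b - a) + τ • (d - a) - a) = τ * cr (b - a) (d - a) := by
    simp only [cr, Prod.fst_sub, Prod.snd_sub, Prod.fst_add, Prod.snd_add, Prod.smul_fst, Prod.smul_snd,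
        smul_eq_mul]; ring
  have e2 : cr (a + (1 / 2 : ℝ) • (b - a) + τ • (d - a) - a) (d - a) = 1 / 2 * cr (b - a) (d - a) := by
    simp only [cr, Prod.fst_sub, Prod.snd_sub, Prod.fst_add, Prod.snd_add, Prod.smul_fst, Prod.smul_snd,
        smul_eq_mul]; ring
  refine ⟨?_, ?_, ?_, ?_⟩
  · rw [e1]; positivity
  · rw [e1]; nlinarith
  · rw [e2]; positivity
  · rw [e2]; linarith

lemma rh_unique {a b c d c' d' : V} (h : Δ.Rh a b c d) (h' : Δ.Rh a b c' d') : c = c' ∧ d = d' := by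
  have hK := h.2.2.2.2.2.1
  have hK' := h'.2.2.2.2.2.1
  obtain ⟨M, hM⟩ : ∃ M, M = cr (Δ.P d' - Δ.P a) (Δ.P d - Δ.P a) := ⟨_, rfl⟩
  have hA := abs_nonneg M
  have a1 := le_abs_self M
  have a2 := neg_abs_le M
  set K := cr (Δ.P b - Δ.P a) (Δ.P d - Δ.P a) with hKd
  set K' := cr (Δ.P b - Δ.P a) (Δ.P d' - Δ.P a) with hKd'
  have hD : 0 < 2 * (K + K' + |M|) := by linarith
  obtain ⟨ε, hε⟩ : ∃ ε, ε = K / (2 * (K + K' + |M|)) := ⟨_, rfl⟩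
  have hεD : ε * (2 * (K + K' + |M|)) = K := by rw [hε]; field_simp
  have ε0 : 0 < ε := by rw [hε]; positivity
  have ε1 : ε < 1 := by
    by_contra hc
    push Not at hc
    nlinarith
  have i' := inPar_rib hK' ε0 ε1
  have b1 : ε * K' < K := by nlinarith
  have b2 : ε * |M| < K / 2 := by nlinarith
  have e1 : cr (Δ.P b - Δ.P a) (Δ.P a + (1 / 2 : ℝ) • (Δ.P b - Δ.P a) + ε • (Δ.P d' - Δ.P a) - Δ.P a) =
      ε * K' := by
    simp only [hKd', cr, Prod.fst_sub, Prod.snd_sub, Prod.fst_add, Prod.snd_add, Prod.smul_fst, Prod.smul_snd,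
        smul_eq_mul]; ring
  have e2 : cr (Δ.P a + (1 / 2 : ℝ) • (Δ.P b - Δ.P a) + ε • (Δ.P d' - Δ.P a) - Δ.P a) (Δ.P d - Δ.P a) =
      K / 2 + ε * M := by
    simp only [hKd, hM, cr, Prod.fst_sub, Prod.snd_sub, Prod.fst_add, Prod.snd_add, Prod.smul_fst, Prod.smul_snd,
        smul_eq_mul]; ring
  have i : InPar (Δ.P a) (Δ.P b) (Δ.P d) (Δ.P a + (1 / 2 : ℝ) • (Δ.P b - Δ.P a) + ε • (Δ.P d' - Δ.P a)) := by
    refine ⟨?_, ?_, ?_, ?_⟩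
    · rw [e1]; positivity
    · rw [e1]; exact b1
    · rw [e2]; nlinarith
    · rw [e2]; change _ < K; nlinarith
  exact (Δ.same h h' i i').2

end Drw


namespace Drw

variable {V : Type} {G : SimpleGraph V} (Δ : Drw G)

/-- step across an empty parallelogram -/
def St (x y : V × V) : Prop := Δ.Rh x.1 x.2 y.2 y.1

/-- reachability -/
abbrev Ch (x y : V × V) : Prop := Relation.ReflTransGen Δ.St x y

/-- direction -/
def dir (x : V × V) : ℝ × ℝ := Δ.P x.2 - Δ.P x.1

/-- midpoint -/
noncomputable def mid (x : V × V) : ℝ × ℝ := Δ.P x.1 + (1 / 2 : ℝ) • (Δ.P x.2 - Δ.P x.1)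

variable {Δ}

lemma St.right_unique {x y z : V × V} (h : Δ.St x y) (h' : Δ.St x z) : y = z := by
  obtain ⟨h1, h2⟩ := Δ.rh_unique h h'
  exact Prod.ext h2 h1

lemma St.left_unique {x y z : V × V} (h : Δ.St x z) (h' : Δ.St y z) : x = y := by
  obtain ⟨h1, h2⟩ := Δ.rh_unique (Rh.rot (Rh.rot h)) (Rh.rot (Rh.rot h'))
  exact Prod.ext h1 h2

lemma St.dir_eq {x y : V × V} (h : Δ.St x y) : Δ.dir y = Δ.dir x := Rh.fwd h

lemma St.lt {x y : V × V} (h : Δ.St x y) : cr (Δ.dir x) (Δ.P x.1) < cr (Δ.dir x) (Δ.P y.1) := by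
  have := h.2.2.2.2.2.1
  rw [cr_sub_right] at this
  exact sub_pos.1 this

lemma Ch.dir_eq {x y : V × V} (h : Δ.Ch x y) : Δ.dir y = Δ.dir x := by
  induction h with
  | refl => rfl
  | tail _ h ih => rw [h.dir_eq, ih]

lemma Ch.le {x y : V × V} (h : Δ.Ch x y) : cr (Δ.dir x) (Δ.P x.1) ≤ cr (Δ.dir x) (Δ.P y.1) := by
  induction h with
  | refl => rfl
  | tail h1 h ih =>
    have := h.lt
    rw [Ch.dir_eq h1] at this
    exact ih.trans this.le

lemma Ch.comparable {x y t : V × V} (h : Δ.Ch x t) (h' : Δ.Ch y t) : Δ.Ch x y ∨ Δ.Ch y x := by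
  have := Relation.ReflTransGen.total_of_right_unique (r := Function.swap Δ.St)
    (fun _ _ _ h1 h2 => St.left_unique h1 h2) (Relation.reflTransGen_swap.2 h) (Relation.reflTransGen_swap.2 h')
  exact this.symm.imp Relation.reflTransGen_swap.1 Relation.reflTransGen_swap.1

lemma cr_mid (x : V × V) : cr (Δ.dir x) (Δ.mid x) = cr (Δ.dir x) (Δ.P x.1) := by
  simp only [mid, dir, cr_add_right, cr_smul_right, cr_self]; ring

lemma exists_end [Finite V] (x : V × V) (hx : G.Adj x.1 x.2) :
    ∃ t, Δ.Ch x t ∧ G.Adj t.1 t.2 ∧ ¬ ∃ y, Δ.St t y := by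
  have hadj : ∀ y, Δ.Ch x y → G.Adj y.1 y.2 := by
    intro y hy
    rcases Relation.ReflTransGen.cases_tail hy with h | ⟨z, -, h⟩
    · rw [h]; exact hx
    · exact h.2.2.1.symm
  obtain ⟨t, ht, hmax⟩ := Set.exists_max_image {y | Δ.Ch x y} (fun y => cr (Δ.dir x) (Δ.P y.1))
    (Set.toFinite _) ⟨x, Relation.ReflTransGen.refl⟩
  refine ⟨t, ht, hadj t ht, ?_⟩
  rintro ⟨y, hy⟩
  have h1 := hmax y (Relation.ReflTransGen.tail ht hy)
  have h2 := hy.lt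
  rw [Ch.dir_eq ht] at h2
  exact absurd h2 (not_lt.2 h1)

/-- A point of the mid-ribbon of a chain. -/
def OnRib (Δ : Drw G) (x y : V × V) (z : ℝ × ℝ) : Prop :=
  (∃ p, Δ.Ch x p ∧ Δ.Ch p y ∧ z = Δ.mid p) ∨
  (∃ p q, Δ.Ch x p ∧ Δ.St p q ∧ Δ.Ch q y ∧ ∃ τ : ℝ, 0 < τ ∧ τ < 1 ∧ z = Δ.mid p + τ • (Δ.mid q - Δ.mid p))

lemma OnRib.tail {x y y' : V × V} {z : ℝ × ℝ} (h : Δ.OnRib x y z) (h' : Δ.St y y') : Δ.OnRib x y' z := by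
  rcases h with ⟨p, h1, h2, h3⟩ | ⟨p, q, h1, h2, h3, h4⟩
  · exact Or.inl ⟨p, h1, Relation.ReflTransGen.tail h2 h', h3⟩
  · exact Or.inr ⟨p, q, h1, h2, Relation.ReflTransGen.tail h3 h', h4⟩

lemma ribbon (v : ℝ × ℝ) {x y : V × V} (h : Δ.Ch x y) :
    ∃ f : ℝ → ℝ, Continuous f ∧ (∀ t, t ≤ cr (Δ.dir x) (Δ.P x.1) → f t = cr v (Δ.mid x)) ∧
      (∀ t, cr (Δ.dir x) (Δ.P y.1) ≤ t → f t = cr v (Δ.mid y)) ∧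
      ∀ t, cr (Δ.dir x) (Δ.P x.1) ≤ t → t ≤ cr (Δ.dir x) (Δ.P y.1) →
        ∃ z, Δ.OnRib x y z ∧ cr (Δ.dir x) z = t ∧ cr v z = f t := by
  induction h with
  | refl =>
    refine ⟨fun _ => cr v (Δ.mid x), continuous_const, fun _ _ => rfl, fun _ _ => rfl, fun t h1 h2 => ?_⟩
    refine ⟨Δ.mid x, Or.inl ⟨x, Relation.ReflTransGen.refl, Relation.ReflTransGen.refl, rfl⟩, ?_, rfl⟩
    rw [cr_mid]; linarith
  | @tail y y' h1 h ih =>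
    obtain ⟨f, fc, f0, f1, f2⟩ := ih
    have hlt := h.lt
    rw [Ch.dir_eq h1] at hlt
    have hle := Ch.le h1
    have m1 := cr_mid (Δ := Δ) y
    have m2 := cr_mid (Δ := Δ) y'
    rw [St.dir_eq h] at m2
    rw [Ch.dir_eq h1] at m1 m2
    set α := cr (Δ.dir x) (Δ.P y.1)
    set β := cr (Δ.dir x) (Δ.P y'.1)
    have hβ : 0 < β - α := by linarith
    refine ⟨fun t => f t + max 0 (min 1 ((t - α) / (β - α))) * (cr v (Δ.mid y') - cr v (Δ.mid y)), by fun_prop, ?_, ?_, ?_⟩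
    · intro t ht
      have : (t - α) / (β - α) ≤ 0 := div_nonpos_of_nonpos_of_nonneg (by linarith) hβ.le
      simp only
      rw [f0 t ht, max_eq_left ((min_le_right _ _).trans this)]; ring
    · intro t ht
      have : 1 ≤ (t - α) / (β - α) := by rw [le_div_iff₀ hβ]; linarith
      simp only
      rw [f1 t (by linarith), min_eq_left this, max_eq_right zero_le_one]; ring
    · intro t t0 t1
      rcases le_or_gt t α with k | k
      · obtain ⟨z, hz, hz1, hz2⟩ := f2 t t0 k
        refine ⟨z, hz.tail h, hz1, ?_⟩
        have : (t - α) / (β - α) ≤ 0 := div_nonpos_of_nonpos_of_nonneg (by linarith) hβ.le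
        simp only
        rw [max_eq_left ((min_le_right _ _).trans this), hz2]; ring
      rcases t1.eq_or_lt with k' | k'
      · refine ⟨Δ.mid y', Or.inl ⟨y', Relation.ReflTransGen.tail h1 h, Relation.ReflTransGen.refl, rfl⟩, ?_, ?_⟩
        · rw [m2, k']
        · simp only
          rw [f1 t k.le, k', div_self hβ.ne', min_self, max_eq_right zero_le_one]; ring
      · have s0 : 0 < (t - α) / (β - α) := div_pos (by linarith) hβ
        have s1 : (t - α) / (β - α) < 1 := by rw [div_lt_one hβ]; linarith
        refine ⟨_, Or.inr ⟨y, y', h1, h, Relation.ReflTransGen.refl, (t - α) / (β - α), s0, s1, rfl⟩, ?_, ?_⟩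
        · rw [cr_add_right, cr_smul_right, cr_sub_right, m1, m2]
          field_simp; ring
        · simp only
          rw [f1 t k.le, cr_add_right, cr_smul_right, cr_sub_right, min_eq_right s1.le, max_eq_right s0.le]

lemma St.inPar {p q : V × V} (h : Δ.St p q) {τ : ℝ} (h0 : 0 < τ) (h1 : τ < 1) :
    InPar (Δ.P p.1) (Δ.P p.2) (Δ.P q.1) (Δ.mid p + τ • (Δ.mid q - Δ.mid p)) := by
  have := inPar_rib h.2.2.2.2.2.1 h0 h1
  convert this using 1
  have e : Δ.P q.2 - Δ.P q.1 = Δ.P p.2 - Δ.P p.1 := h.dir_eq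
  simp only [mid, e]
  module

/-- Two crossing ribbons meet in a common parallelogram. -/
lemma cross_rib {x y x' y' : V × V} {u w z : ℝ × ℝ} (hu : Δ.dir x = u) (hw : Δ.dir x' = w) (hK : 0 < cr u w)
    (h1 : Δ.OnRib x y z) (h2 : Δ.OnRib x' y' z)
    (hx : G.Adj x.1 x.2) (hx' : G.Adj x'.1 x'.2) :
    ∃ p q r s, Δ.Rh p q r s ∧ Δ.Ch x (p, q) ∧ Δ.Ch (s, r) y ∧ Δ.Ch (p, s) y' := by
  have hadj : ∀ {x y}, Δ.Ch x y → G.Adj x.1 x.2 → G.Adj y.1 y.2 := by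
    intro x y hy hx
    rcases Relation.ReflTransGen.cases_tail hy with h | ⟨z, -, h⟩
    · rw [h]; exact hx
    · exact h.2.2.1.symm
  rcases h1 with ⟨p, c1, c2, rfl⟩ | ⟨p, q, c1, c2, c3, τ, τ0, τ1, rfl⟩
  · rcases h2 with ⟨p', c1', c2', h⟩ | ⟨p', q', c1', c2', c3', τ, τ0, τ1, h⟩
    · exfalso
      refine Δ.crs p.1 p.2 p'.1 p'.2 (hadj c1 hx) (hadj c1' hx') ?_ (1/2) (1/2) (by norm_num) (by norm_num)
        (by norm_num) (by norm_num) h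
      intro hs
      have d1 := Ch.dir_eq c1
      have d2 := Ch.dir_eq c1'
      rw [hu] at d1
      rw [hw] at d2
      rw [← d1, ← d2] at hK
      simp only [dir] at hK
      rcases Sym2.eq_iff.1 hs with ⟨e1, e2⟩ | ⟨e1, e2⟩
      · rw [e1, e2, cr_self] at hK
        exact lt_irrefl _ hK
      · rw [e1, e2] at hK
        simp only [cr, Prod.fst_sub, Prod.snd_sub] at hK
        linarith
    · exfalso
      refine c2'.2.2.2.2.2.2 p.1 p.2 (hadj c1 hx) (1 / 2) (by norm_num) (by norm_num) ?_
      change InPar _ _ _ (Δ.mid p)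
      rw [h]
      exact c2'.inPar τ0 τ1
  · rcases h2 with ⟨p', c1', c2', h⟩ | ⟨p', q', c1', c2', c3', τ', τ0', τ1', h⟩
    · exfalso
      refine c2.2.2.2.2.2.2 p'.1 p'.2 (hadj c1' hx') (1 / 2) (by norm_num) (by norm_num) ?_
      change InPar _ _ _ (Δ.mid p')
      rw [← h]
      exact c2.inPar τ0 τ1
    · have i1 := c2.inPar τ0 τ1
      have i2 := c2'.inPar τ0' τ1'
      rw [← h] at i2
      generalize Δ.mid p + τ • (Δ.mid q - Δ.mid p) = z at i1 i2
      have d1 := Ch.dir_eq c1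
      have d2 := Ch.dir_eq c1'
      rw [hu] at d1
      rw [hw] at d2
      obtain ⟨a, b⟩ := p
      obtain ⟨d, c⟩ := q
      obtain ⟨a', b'⟩ := p'
      obtain ⟨d', c'⟩ := q'
      have r1 : Δ.Rh a b c d := c2
      have r2 : Δ.Rh a' b' c' d' := c2'
      simp only at i1 i2
      have j1 := (inPar_rot r2.2.2.2.2.1).2 i2
      have j2 := (inPar_rot r2.rot.2.2.2.2.1).2 j1
      have j3 := (inPar_rot r2.rot.rot.2.2.2.2.1).2 j2
      have k := r1.2.2.2.2.2.1
      have f := r1.fwd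
      rw [← d1, ← d2] at hK
      simp only [dir] at hK
      rcases Δ.corner r1 r2 i1 i2 with rfl | rfl | rfl | rfl
      · exfalso
        obtain ⟨rfl, rfl, rfl⟩ := Δ.same r1 r2 i1 i2
        rw [cr_self] at hK
        exact lt_irrefl _ hK
      · exfalso
        obtain ⟨rfl, rfl, rfl⟩ := Δ.same r1 r2.rot i1 j1
        simp only [cr, Prod.fst_sub, Prod.snd_sub] at hK k
        linarith
      · exfalso
        obtain ⟨rfl, rfl, rfl⟩ := Δ.same r1 r2.rot.rot i1 j2
        rw [← neg_sub (Δ.P c) (Δ.P d), f] at hK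
        simp only [cr, Prod.fst_sub, Prod.snd_sub, Prod.fst_neg, Prod.snd_neg] at hK
        linarith
      · obtain ⟨rfl, rfl, rfl⟩ := Δ.same r1 r2.rot.rot.rot i1 j3
        exact ⟨_, _, _, _, r1, c1, c3, c3'⟩

end Drw


namespace Drw

variable {V : Type} {G : SimpleGraph V} {Δ : Drw G}

/-- intermediate value argument for two crossing ribbons -/
lemma third {u w : ℝ × ℝ} (hK : 0 < cr u w) {x y x' y' : V × V} (hx : G.Adj x.1 x.2) (hx' : G.Adj x'.1 x'.2)
    (hu : Δ.dir x = u) (hw : Δ.dir x' = w) (h : Δ.Ch x y) (h' : Δ.Ch x' y')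
    {A A' B B' : ℝ} (hxA : cr u (Δ.P x.1) = A + cr u w) (hyA : cr u (Δ.P y.1) = A')
    (hAA : A + cr u w ≤ A')
    (hxB : cr w (Δ.mid x) = B - cr u w / 2) (hyB : cr w (Δ.mid y) = B' - cr u w / 2)
    (hcase : (cr u (Δ.mid x') = A + cr u w / 2 ∧ cr u (Δ.mid y') = A' + cr u w / 2 ∧
        cr w (Δ.P x'.1) = B ∧ cr w (Δ.P y'.1) = B' - cr u w) ∨
      (cr u (Δ.mid x') = A' + cr u w / 2 ∧ cr u (Δ.mid y') = A + cr u w / 2 ∧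
        cr w (Δ.P x'.1) = B' ∧ cr w (Δ.P y'.1) = B - cr u w)) :
    ∃ p q r s, Δ.Rh p q r s ∧ Δ.Ch x (p, q) ∧ Δ.Ch (s, r) y ∧ Δ.Ch (p, s) y' := by
  obtain ⟨f, fc, f0, f1, f2⟩ := ribbon w h
  obtain ⟨g, gc, g0, g1, g2⟩ := ribbon u h'
  rw [hu] at f0 f1 f2
  rw [hw] at g0 g1 g2
  set K := cr u w
  have gA : g (B - K / 2) = A + K / 2 := by
    rcases hcase with ⟨k1, k2, k3, k4⟩ | ⟨k1, k2, k3, k4⟩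
    · rw [g0 _ (by rw [k3]; linarith), k1]
    · rw [g1 _ (by rw [k4]; linarith), k2]
  have gA' : g (B' - K / 2) = A' + K / 2 := by
    rcases hcase with ⟨k1, k2, k3, k4⟩ | ⟨k1, k2, k3, k4⟩
    · rw [g1 _ (by rw [k4]; linarith), k2]
    · rw [g0 _ (by rw [k3]; linarith), k1]
  have hc : Continuous (fun s => s - g (f s)) := by fun_prop
  have := intermediate_value_Icc' hAA hc.continuousOn
  obtain ⟨s, ⟨s0, s1⟩, hs⟩ := this (show (0 : ℝ) ∈ _ by
    constructor
    · rw [f1 A' hyA.le, hyB, gA']; linarith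
    · rw [f0 (A + K) hxA.ge, hxB, gA]; linarith)
  simp only at hs
  obtain ⟨z, hz, hz1, hz2⟩ := f2 s (by rw [hxA]; exact s0) (by rw [hyA]; exact s1)
  have hlo : cr w (Δ.P x'.1) ≤ f s := by
    by_contra hcon
    push Not at hcon
    have e := g0 _ hcon.le
    rw [e] at hs
    rcases hcase with ⟨k1, k2, k3, k4⟩ | ⟨k1, k2, k3, k4⟩ <;> rw [k1] at hs <;> linarith
  have hhi : f s ≤ cr w (Δ.P y'.1) := by
    by_contra hcon
    push Not at hcon
    have e := g1 _ hcon.le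
    rw [e] at hs
    rcases hcase with ⟨k1, k2, k3, k4⟩ | ⟨k1, k2, k3, k4⟩ <;> rw [k2] at hs <;> linarith
  obtain ⟨z', hz', hz1', hz2'⟩ := g2 (f s) hlo hhi
  have hzz : z = z' := by
    refine cr_ext hK.ne' ?_ ?_
    · rw [hz1, hz2']; linarith
    · rw [hz2, hz1']
  subst hzz
  exact cross_rib hu hw hK hz hz' hx hx'

lemma ends_inj [Finite V] {a b c d a' b' c' d' : V} {t₁ t₂ : V × V} (h : Δ.Rh a b c d) (h' : Δ.Rh a' b' c' d')
    (e1 : Δ.Ch (a, b) t₁) (e1' : Δ.Ch (a', b') t₁) (e2 : Δ.Ch (a, d) t₂) (e2' : Δ.Ch (a', d') t₂) :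
    a = a' ∧ b = b' := by
  obtain ⟨u, hu⟩ : ∃ u, u = Δ.dir t₁ := ⟨_, rfl⟩
  obtain ⟨w, hw⟩ : ∃ w, w = Δ.dir t₂ := ⟨_, rfl⟩
  let C : Set (V × V) := {x | ∃ r s, Δ.Rh x.1 x.2 r s ∧ Δ.Ch x t₁ ∧ Δ.Ch (x.1, s) t₂}
  let η : V × V → ℝ := fun x => cr u (Δ.P x.1)
  have dirC : ∀ x ∈ C, Δ.dir x = u := by
    rintro x ⟨r, s, -, h1, -⟩
    rw [hu, Ch.dir_eq h1]
  have strict : ∀ x ∈ C, ∀ y ∈ C, Δ.Ch x y → x ≠ y → η x < η y := by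
    intro x hx y hy hxy hne
    rcases Relation.ReflTransGen.cases_head hxy with k | ⟨z, k1, k2⟩
    · exact absurd k hne
    · have l1 := k1.lt
      have l2 := Ch.le k2
      rw [k1.dir_eq] at l2
      rw [dirC x hx] at l1 l2
      exact lt_of_lt_of_le l1 l2
  have main : ∀ x ∈ C, ∀ y ∈ C, η x < η y → False := by
    intro x hx y0 hy0 hlt0
    obtain ⟨y, ⟨hy, hlt⟩, hmin⟩ := Set.exists_min_image {y | y ∈ C ∧ η x < η y} η (Set.toFinite _) ⟨y0, hy0, hlt0⟩
    have hne : x ≠ y := by rintro rfl; exact lt_irrefl _ hlt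
    have dx := dirC x hx
    have dy := dirC y hy
    obtain ⟨a, b⟩ := x
    obtain ⟨a', b'⟩ := y
    obtain ⟨c, d, r1, t1, t2⟩ := id hx
    obtain ⟨c', d', r1', t1', t2'⟩ := id hy
    simp only at r1 r1' t2 t2'
    have hch : Δ.Ch (a, b) (a', b') := by
      rcases Ch.comparable t1 t1' with k | k
      · exact k
      · exact absurd (strict _ hy _ hx k hne.symm) (not_lt.2 hlt.le)
    have hch' : Δ.Ch (d, c) (a', b') := by
      rcases Relation.ReflTransGen.cases_head hch with k | ⟨z, k1, k2⟩
      · exact absurd k hne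
      · have : z = (d, c) := St.right_unique k1 r1
        rwa [this] at k2
    have du : Δ.dir (d, c) = u := by rw [← dx]; exact r1.fwd
    have fw : Δ.P d - Δ.P a = w := by rw [hw, Ch.dir_eq t2]; rfl
    have fw' : Δ.P d' - Δ.P a' = w := by rw [hw, Ch.dir_eq t2']; rfl
    have fu : Δ.P b - Δ.P a = u := dx
    have fu' : Δ.P b' - Δ.P a' = u := dy
    have fc := r1.fwd
    have fc' := r1'.fwd
    rw [fu] at fc
    rw [fu'] at fc'
    have hb : Δ.P b = Δ.P a + u := by rw [← fu]; abel
    have hd : Δ.P d = Δ.P a + w := by rw [← fw]; abel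
    have hcc : Δ.P c = Δ.P a + w + u := by rw [← fc, ← hd]; abel
    have hb' : Δ.P b' = Δ.P a' + u := by rw [← fu']; abel
    have hd' : Δ.P d' = Δ.P a' + w := by rw [← fw']; abel
    have hcc' : Δ.P c' = Δ.P a' + w + u := by rw [← fc', ← hd']; abel
    have hK : 0 < cr u w := by
      have := r1.2.2.2.2.2.1
      rwa [fu, fw] at this
    have hwu : cr w u = - cr u w := cr_anti _ _
    have s1 : Δ.St (b, c) (a, d) := r1.rot
    have s1' : Δ.St (b', c') (a', d') := r1'.rot
    have haa : a ≠ a' := by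
      rintro rfl
      exact lt_irrefl _ hlt
    have hdd : (a, d) ≠ (a', d') := fun k => haa (congrArg Prod.fst k)
    have dw : Δ.dir (a, d) = w := fw
    have dw' : Δ.dir (a', d') = w := fw'
    have m1 : Δ.mid (d, c) = Δ.P a + w + (1 / 2 : ℝ) • u := by simp only [mid, hd, hcc]; module
    have m2 : Δ.mid (a', b') = Δ.P a' + (1 / 2 : ℝ) • u := by simp only [mid, hb']; module
    have m3 : Δ.mid (a, d) = Δ.P a + (1 / 2 : ℝ) • w := by simp only [mid, hd]; module
    have m4 : Δ.mid (b, c) = Δ.P a + u + (1 / 2 : ℝ) • w := by simp only [mid, hb, hcc]; module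
    have m3' : Δ.mid (a', d') = Δ.P a' + (1 / 2 : ℝ) • w := by simp only [mid, hd']; module
    have m4' : Δ.mid (b', c') = Δ.P a' + u + (1 / 2 : ℝ) • w := by simp only [mid, hb', hcc']; module
    have q1 : cr u (Δ.P d) = cr u (Δ.P a) + cr u w := by rw [hd, cr_add_right]
    have q2 : cr u (Δ.P a) + cr u w ≤ cr u (Δ.P a') := by
      have := Ch.le hch'
      rw [du] at this
      rw [← q1]; exact this
    have q3 : cr w (Δ.mid (d, c)) = cr w (Δ.P a) - cr u w / 2 := by
      rw [m1, cr_add_right, cr_add_right, cr_smul_right, cr_self, hwu]; ring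
    have q4 : cr w (Δ.mid (a', b')) = cr w (Δ.P a') - cr u w / 2 := by
      rw [m2, cr_add_right, cr_smul_right, hwu]; ring
    have fin : ∃ p q r s, Δ.Rh p q r s ∧ Δ.Ch (d, c) (p, q) ∧ Δ.Ch (s, r) (a', b') ∧ Δ.Ch (p, s) t₂ := by
      rcases Ch.comparable t2 t2' with k | k
      · have k' : Δ.Ch (a, d) (b', c') := by
          rcases Relation.ReflTransGen.cases_tail k with j | ⟨z, j1, j2⟩
          · exact absurd j.symm hdd
          · rwa [St.left_unique j2 s1'] at j1
        obtain ⟨p, q, r, s, g1, g2, g3, g4⟩ := third hK r1.2.2.1.symm r1.2.2.2.1.symm du dw hch' k' q1 rfl q2 q3 q4 (Or.inl ⟨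
          by rw [m3, cr_add_right, cr_smul_right]; ring,
          by rw [m4', cr_add_right, cr_add_right, cr_smul_right, cr_self]; ring, rfl,
          by rw [hb', cr_add_right, hwu]; ring⟩)
        exact ⟨p, q, r, s, g1, g2, g3, (Relation.ReflTransGen.tail g4 s1').trans t2'⟩
      · have k' : Δ.Ch (a', d') (b, c) := by
          rcases Relation.ReflTransGen.cases_tail k with j | ⟨z, j1, j2⟩
          · exact absurd j hdd
          · rwa [St.left_unique j2 s1] at j1
        obtain ⟨p, q, r, s, g1, g2, g3, g4⟩ := third hK r1.2.2.1.symm r1'.2.2.2.1.symm du dw' hch' k' q1 rfl q2 q3 q4 (Or.inr ⟨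
          by rw [m3', cr_add_right, cr_smul_right]; ring,
          by rw [m4, cr_add_right, cr_add_right, cr_smul_right, cr_self]; ring, rfl,
          by rw [hb, cr_add_right, hwu]; ring⟩)
        exact ⟨p, q, r, s, g1, g2, g3, (Relation.ReflTransGen.tail g4 s1).trans t2⟩
    obtain ⟨p, q, r, s, g1, g2, g3, g4⟩ := fin
    have gs : Δ.St (p, q) (s, r) := g1
    have hpC : (p, q) ∈ C := ⟨r, s, g1, (Relation.ReflTransGen.head gs g3).trans t1', g4⟩
    have dp := dirC _ hpC
    have l1 := Ch.le g2
    rw [du] at l1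
    have l2 := gs.lt
    rw [dp] at l2
    have l3 := Ch.le g3
    rw [gs.dir_eq, dp] at l3
    simp only at l1 l2 l3
    have := hmin (p, q) ⟨hpC, by simp only [η]; linarith⟩
    simp only [η] at this
    linarith
  have hC : (a, b) ∈ C := ⟨c, d, h, e1, e2⟩
  have hC' : (a', b') ∈ C := ⟨c', d', h', e1', e2'⟩
  by_contra hcon
  have hne : (a, b) ≠ (a', b') := by
    intro k
    exact hcon (Prod.mk.injEq .. ▸ k)
  rcases Ch.comparable e1 e1' with k | k
  · exact main _ hC _ hC' (strict _ hC _ hC' k hne)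
  · exact main _ hC' _ hC (strict _ hC' _ hC k hne.symm)

variable (Δ)

theorem partB [Finite V] :
    2 * Nat.card {d // Δ.Rd d} + Nat.card {d // ¬ Δ.Rd d} ≤ Nat.card {d // ¬ Δ.Rd d} * Nat.card {d // ¬ Δ.Rd d} := by
  classical
  have : Fintype V := Fintype.ofFinite V
  have hE : ∀ x : G.Dart, ∃ t : {d // ¬ Δ.Rd d}, Δ.Ch x.toProd t.1.toProd := by
    intro x
    obtain ⟨t, h1, h2, h3⟩ := exists_end (Δ := Δ) x.toProd x.adj
    refine ⟨⟨⟨t, h2⟩, ?_⟩, h1⟩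
    rintro ⟨c, d, h⟩
    exact h3 ⟨(d, c), h⟩
  choose E hE using hE
  choose c d hcd using fun x : {d // Δ.Rd d} => x.2
  let Φ : {d // Δ.Rd d} → {d // ¬ Δ.Rd d} × {d // ¬ Δ.Rd d} := fun x =>
    (E x.1, E ⟨(x.1.fst, d x), (hcd x).2.2.2.1.symm⟩)
  have hinj : Function.Injective Φ := by
    intro x y hxy
    have h1 := congrArg Prod.fst hxy
    have h2 := congrArg Prod.snd hxy
    simp only [Φ] at h1 h2
    have k1 := hE x.1
    have k2 := hE y.1
    have k3 := hE ⟨(x.1.fst, d x), (hcd x).2.2.2.1.symm⟩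
    have k4 := hE ⟨(y.1.fst, d y), (hcd y).2.2.2.1.symm⟩
    rw [h1] at k1
    rw [h2] at k3
    obtain ⟨j1, j2⟩ := ends_inj (hcd x) (hcd y) k1 k2 k3 k4
    apply Subtype.ext
    apply SimpleGraph.Dart.ext
    exact Prod.ext j1 j2
  have hpos : ∀ x, 0 < cr (Δ.dir (Φ x).1.1.toProd) (Δ.dir (Φ x).2.1.toProd) := by
    intro x
    have k1 := Ch.dir_eq (hE x.1)
    have k3 := Ch.dir_eq (hE ⟨(x.1.fst, d x), (hcd x).2.2.2.1.symm⟩)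
    change 0 < cr (Δ.dir (E x.1).1.toProd) (Δ.dir (E ⟨(x.1.fst, d x), (hcd x).2.2.2.1.symm⟩).1.toProd)
    rw [k1, k3]
    exact (hcd x).2.2.2.2.2.1
  let I := Finset.univ.image Φ
  have hI : I.card = Nat.card {d // Δ.Rd d} := by
    rw [Finset.card_image_of_injective _ hinj, Finset.card_univ, Nat.card_eq_fintype_card]
  let J := I.image Prod.swap
  have hJ : J.card = Nat.card {d // Δ.Rd d} := by
    rw [Finset.card_image_of_injective _ Prod.swap_injective, hI]
  have hdis : Disjoint I J := by
    rw [Finset.disjoint_left]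
    intro z hz hz'
    simp only [I, J, Finset.mem_image, Finset.mem_univ, true_and] at hz hz'
    obtain ⟨x, rfl⟩ := hz
    obtain ⟨_, ⟨y, rfl⟩, hy⟩ := hz'
    have p1 := hpos x
    have p2 := hpos y
    rw [← hy, cr_anti] at p1
    simp only [Prod.fst_swap, Prod.snd_swap] at p1
    linarith
  have hsub : I ∪ J ⊆ (Finset.univ : Finset {d // ¬ Δ.Rd d}).offDiag := by
    intro z hz
    simp only [Finset.mem_offDiag, Finset.mem_univ, true_and]
    intro heq
    simp only [I, J, Finset.mem_union, Finset.mem_image, Finset.mem_univ, true_and] at hz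
    rcases hz with ⟨x, rfl⟩ | ⟨_, ⟨x, rfl⟩, rfl⟩
    · have := hpos x
      rw [heq, cr_self] at this
      exact lt_irrefl _ this
    · have := hpos x
      simp only [Prod.fst_swap, Prod.snd_swap] at heq
      rw [heq, cr_self] at this
      exact lt_irrefl _ this
  have hle := Finset.card_le_card hsub
  rw [Finset.card_union_of_disjoint hdis, hI, hJ, Finset.offDiag_card, Finset.card_univ,
    ← Nat.card_eq_fintype_card] at hle
  have : Nat.card {d // ¬ Δ.Rd d} ≤ Nat.card {d // ¬ Δ.Rd d} * Nat.card {d // ¬ Δ.Rd d} := Nat.le_mul_self _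
  omega

end Drw


section build

variable {V : Type} [Finite V] {G : SimpleGraph V}

lemma exists_shear {p : V → EuclideanSpace ℝ (Fin 2)} (hp : Function.Injective p) :
    ∃ t : ℝ, Function.Injective (fun v => p v 0 + t * p v 1) := by
  obtain ⟨t, ht⟩ := (Set.finite_range (fun x : V × V => -(p x.1 0 - p x.2 0) / (p x.1 1 - p x.2 1))).exists_notMem
  refine ⟨t, fun v v' h => ?_⟩
  simp only at h
  apply hp
  by_cases h1 : p v 1 - p v' 1 = 0
  · ext i
    fin_cases i
    · have h2 : p v 1 = p v' 1 := by linarith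
      rw [h2] at h
      exact add_right_cancel h
    · exact sub_eq_zero.1 h1
  · exfalso
    refine ht ⟨(v, v'), ?_⟩
    simp only
    rw [div_eq_iff h1]
    linarith

lemma unit_sq {x y : EuclideanSpace ℝ (Fin 2)} (h : dist x y = 1) :
    (x 0 - y 0) ^ 2 + (x 1 - y 1) ^ 2 = 1 := by
  rw [EuclideanSpace.dist_eq, Real.sqrt_eq_one] at h
  simpa [Fin.sum_univ_two, Real.dist_eq, sq_abs] using h

lemma rhombus_par {a b c d : EuclideanSpace ℝ (Fin 2)} (h1 : dist a b = 1) (h2 : dist b c = 1) (h3 : dist c d = 1)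
    (h4 : dist d a = 1) (hac : a ≠ c) (hbd : b ≠ d) : a 0 + c 0 = b 0 + d 0 ∧ a 1 + c 1 = b 1 + d 1 := by
  have e1 := unit_sq h1
  have e2 := unit_sq h2
  have e3 := unit_sq h3
  have e4 := unit_sq h4
  have nz : ∀ x y : EuclideanSpace ℝ (Fin 2), x ≠ y → 0 < (x 0 - y 0) ^ 2 + (x 1 - y 1) ^ 2 := by
    intro x y hxy
    by_contra hcon
    apply hxy
    have q1 := sq_nonneg (x 0 - y 0)
    have q2 := sq_nonneg (x 1 - y 1)
    have z1 : (x 0 - y 0) ^ 2 = 0 := by linarith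
    have z2 : (x 1 - y 1) ^ 2 = 0 := by linarith
    ext i
    fin_cases i
    · exact sub_eq_zero.1 (pow_eq_zero_iff two_ne_zero |>.1 z1)
    · exact sub_eq_zero.1 (pow_eq_zero_iff two_ne_zero |>.1 z2)
  have n1 := nz _ _ hac
  have n2 := nz _ _ hbd
  have s1 : (a 0 + c 0 - b 0 - d 0) * (a 0 - c 0) + (a 1 + c 1 - b 1 - d 1) * (a 1 - c 1) = 0 := by
    linear_combination (e1 - e2 - e3 + e4) / 2
  have s2 : (a 0 + c 0 - b 0 - d 0) * (b 0 - d 0) + (a 1 + c 1 - b 1 - d 1) * (b 1 - d 1) = 0 := by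
    linear_combination (-e1 - e2 + e3 + e4) / 2
  have s3 : (a 0 - c 0) * (b 0 - d 0) + (a 1 - c 1) * (b 1 - d 1) = 0 := by
    linear_combination (-e1 + e2 - e3 + e4) / 2
  have hX : (a 0 - c 0) * (b 1 - d 1) - (a 1 - c 1) * (b 0 - d 0) ≠ 0 := by
    intro h0
    have : ((a 0 - c 0) ^ 2 + (a 1 - c 1) ^ 2) * ((b 0 - d 0) ^ 2 + (b 1 - d 1) ^ 2) = 0 := by
      linear_combination ((a 0 - c 0) * (b 1 - d 1) - (a 1 - c 1) * (b 0 - d 0)) * h0 +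
        ((a 0 - c 0) * (b 0 - d 0) + (a 1 - c 1) * (b 1 - d 1)) * s3
    have := mul_pos n1 n2
    linarith
  constructor
  · have : (a 0 + c 0 - b 0 - d 0) * ((a 0 - c 0) * (b 1 - d 1) - (a 1 - c 1) * (b 0 - d 0)) = 0 := by
      linear_combination (b 1 - d 1) * s1 - (a 1 - c 1) * s2
    have := (mul_eq_zero.1 this).resolve_right hX
    linarith
  · have : (a 1 + c 1 - b 1 - d 1) * ((a 0 - c 0) * (b 1 - d 1) - (a 1 - c 1) * (b 0 - d 0)) = 0 := by
      linear_combination (a 0 - c 0) * s2 - (b 0 - d 0) * s1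
    have := (mul_eq_zero.1 this).resolve_right hX
    linarith

/-- A matchstick embedding gives a drawing in generic position. -/
lemma exists_drw (emb : MatchstickEmbedding G) : Nonempty (Drw G) := by
  obtain ⟨t, ht⟩ := exists_shear emb.inj
  have key : ∀ x y : EuclideanSpace ℝ (Fin 2), x 0 + t * x 1 = y 0 + t * y 1 → x 1 = y 1 → x = y := by
    intro x y h1 h2
    ext i
    fin_cases i
    · rw [h2] at h1
      exact add_right_cancel h1
    · exact h2
  refine ⟨⟨fun v => (emb.pos v 0 + t * emb.pos v 1, emb.pos v 1), ht, ?_, ?_, ?_⟩⟩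
  · intro w a b hab r r0 r1 h
    apply emb.noVertexInterior w a b hab
    rw [openSegment_eq_image]
    refine ⟨r, ⟨r0, r1⟩, ?_⟩
    have h1 := congrArg Prod.fst h
    have h2 := congrArg Prod.snd h
    simp only [Prod.fst_add, Prod.snd_add, Prod.smul_fst, Prod.smul_snd, Prod.fst_sub, Prod.snd_sub,
      smul_eq_mul] at h1 h2
    apply key
    · simp only [PiLp.add_apply, PiLp.smul_apply, smul_eq_mul]; linarith
    · simp only [PiLp.add_apply, PiLp.smul_apply, smul_eq_mul]; linarith
  · intro a b c d hab hcd hne r r' r0 r1 r0' r1' h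
    have h1 := congrArg Prod.fst h
    have h2 := congrArg Prod.snd h
    simp only [Prod.fst_add, Prod.snd_add, Prod.smul_fst, Prod.smul_snd, Prod.fst_sub, Prod.snd_sub,
      smul_eq_mul] at h1 h2
    have he : (1 - r) • emb.pos a + r • emb.pos b = (1 - r') • emb.pos c + r' • emb.pos d := by
      apply key
      · simp only [PiLp.add_apply, PiLp.smul_apply, smul_eq_mul]; linarith
      · simp only [PiLp.add_apply, PiLp.smul_apply, smul_eq_mul]; linarith
    have m1 : (1 - r) • emb.pos a + r • emb.pos b ∈ segment ℝ (emb.pos a) (emb.pos b) := by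
      rw [segment_eq_image]; exact ⟨r, ⟨r0.le, r1.le⟩, rfl⟩
    have m2 : (1 - r) • emb.pos a + r • emb.pos b ∈ segment ℝ (emb.pos c) (emb.pos d) := by
      rw [segment_eq_image, he]; exact ⟨r', ⟨r0', r1'⟩, rfl⟩
    have m3 : (1 - r) • emb.pos a + r • emb.pos b ∈ openSegment ℝ (emb.pos a) (emb.pos b) := by
      rw [openSegment_eq_image]; exact ⟨r, ⟨r0, r1⟩, rfl⟩
    rcases (emb.noncross a b c d hab hcd hne ⟨m1, m2⟩).1 with k | k
    · rw [k] at m3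
      exact emb.noVertexInterior _ _ _ hab m3
    · rw [Set.mem_singleton_iff.1 k] at m3
      exact emb.noVertexInterior _ _ _ hab m3
  · intro a b c d h1 h2 h3 h4 hac hbd
    obtain ⟨k1, k2⟩ := rhombus_par (emb.unit _ _ h1) (emb.unit _ _ h2) (emb.unit _ _ h3) (emb.unit _ _ h4)
      (fun h => hac (emb.inj h)) (fun h => hbd (emb.inj h))
    ext
    · simp only [Prod.fst_add]
      linear_combination k1 + t * k2
    · exact k2

end build

/-- **Theorem 1 (upper bound).** Every triangle-free matchstick graph on `n`
vertices has at most `2n - (√2/5)·√n` edges. -/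
theorem triangleFree_matchstick_upper_bound (n : ℕ) (G : SimpleGraph (Fin n))
    (emb : MatchstickEmbedding G) (htf : G.CliqueFree 3) :
    (G.edgeSet.ncard : ℝ) ≤ 2 * n - Real.sqrt 2 / 5 * Real.sqrt n := by
  classical
  obtain ⟨Δ⟩ := exists_drw emb
  have hN : Nat.card G.Dart = 2 * G.edgeSet.ncard := by
    rw [Nat.card_eq_fintype_card, G.dart_card_eq_twice_card_edges, Set.ncard_eq_toFinset_card']
    rfl
  obtain ⟨s, hs⟩ : ∃ s, s = Real.sqrt 2 * Real.sqrt n := ⟨_, rfl⟩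
  have s0 : 0 ≤ s := by rw [hs]; positivity
  have s2 : s ^ 2 = 2 * n := by
    rw [hs, mul_pow, Real.sq_sqrt (by norm_num), Real.sq_sqrt (by positivity)]
  have hgoal : 2 * (n : ℝ) - Real.sqrt 2 / 5 * Real.sqrt n = s ^ 2 - s / 5 := by
    rw [s2, hs]; ring
  rw [hgoal]
  rcases isEmpty_or_nonempty G.Dart with he | he
  · have h0 : G.edgeSet.ncard = 0 := by
      rw [Nat.card_of_isEmpty] at hN; omega
    rw [h0]
    rcases Nat.eq_zero_or_pos n with rfl | hn
    · have : s = 0 := by rw [hs]; simp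
      rw [this]; simp
    · have : (1 : ℝ) ≤ n := by exact_mod_cast hn
      have : 1 ≤ s := by nlinarith
      push_cast
      nlinarith
  · have hA := Δ.partA htf
    have hB := Δ.partB
    have hsum : Nat.card {d // Δ.Rd d} + Nat.card {d // ¬ Δ.Rd d} = Nat.card G.Dart := by
      rw [Nat.card_eq_fintype_card, Nat.card_eq_fintype_card, Nat.card_eq_fintype_card,
        Fintype.card_subtype_compl]
      have := Fintype.card_subtype_le Δ.Rd
      omega
    rw [Fintype.card_fin] at hA
    generalize Nat.card {d // Δ.Rd d} = ρ at *
    generalize Nat.card {d // ¬ Δ.Rd d} = τ at *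
    generalize G.edgeSet.ncard = e at *
    rw [hN] at hA hsum
    have hA' : 6 * (2 * (e : ℝ)) + 4 ≤ 20 * n + ρ := by exact_mod_cast hA
    have hB' : 2 * (ρ : ℝ) + τ ≤ τ * τ := by exact_mod_cast hB
    have hS' : (ρ : ℝ) + τ = 2 * e := by exact_mod_cast hsum
    have τ0 : (0 : ℝ) ≤ τ := by positivity
    rcases le_or_gt (s - 2) (τ / 2 : ℝ) with h | h
    · linarith
    · have e1 : (e : ℝ) ≤ (τ / 2) ^ 2 + τ / 2 / 2 := by nlinarith
      have e2 : ((τ : ℝ) / 2) ^ 2 ≤ (s - 2) ^ 2 := by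
        apply pow_le_pow_left₀ (by positivity) h.le
      nlinarith
end

section
/- For every real constant c > √2 there exists a positive integer n and a triangle-free matchstick graph on n vertices whose number of edges exceeds 2n - c·√n. (Hence the upper bound 2n - c√n on the number of edges of triangle-free matchstick graphs fails for every c > √2.) -/
/-! Construction: the rhombic tiling of a `2k`-gon whose vertices are the integer intervals
contained in `{0,…,k-1}`; an interval `S` is placed at `∑ i ∈ S, v i` with `v i` the unit vector
in direction `(1, i)`. Injectivity of the drawing follows from a convex lifting argument. -/
namespace MatchstickAux

noncomputable def r (i : ℕ) : ℝ := 1 / Real.sqrt (1 + (i : ℝ) ^ 2)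

lemma r_pos (i : ℕ) : 0 < r i := by unfold r; positivity

lemma r_sq (i : ℕ) : r i ^ 2 * (1 + (i : ℝ) ^ 2) = 1 := by
  unfold r
  rw [div_pow, Real.sq_sqrt (by positivity)]
  field_simp

noncomputable def vec (i : ℕ) : EuclideanSpace ℝ (Fin 2) := !₂[r i, r i * i]

lemma norm_vec (i : ℕ) : ‖vec i‖ = 1 := by
  rw [EuclideanSpace.norm_eq]
  have h : ∑ j : Fin 2, ‖vec i j‖ ^ 2 = 1 := by
    simp only [Fin.sum_univ_two, vec, Real.norm_eq_abs, sq_abs]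
    have := r_sq i
    simp
    linarith
  rw [h, Real.sqrt_one]

/-- linear map from coefficient vectors to the plane -/
noncomputable def L (k : ℕ) (t : ℕ → ℝ) : EuclideanSpace ℝ (Fin 2) :=
  ∑ i ∈ Finset.range k, t i • vec i

lemma L_zero_coord (k : ℕ) (t : ℕ → ℝ) : L k t 0 = ∑ i ∈ Finset.range k, t i * r i := by
  simp [L, vec]

lemma L_one_coord (k : ℕ) (t : ℕ → ℝ) :
    L k t 1 = ∑ i ∈ Finset.range k, t i * (r i * i) := by
  simp [L, vec]

/-- A coefficient vector certified by a quadratic `(x - α)(x - β)`. -/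
def Cert (k : ℕ) (s : ℕ → ℝ) : Prop :=
  (∀ i, 0 ≤ s i ∧ s i ≤ 1) ∧ ∃ e < k, ∃ α β : ℝ,
    (∀ i : ℕ, ((i : ℝ) - α) * (i - β) < 0 → s i = 1) ∧
    (∀ i : ℕ, 0 < ((i : ℝ) - α) * (i - β) → s i = 0) ∧
    (∀ i : ℕ, ((i : ℝ) - α) * (i - β) = 0 → i = e)

lemma lift_term {s t : ℕ → ℝ} (ht : ∀ i, 0 ≤ t i ∧ t i ≤ 1) {α β : ℝ}
    (h1 : ∀ i : ℕ, ((i : ℝ) - α) * (i - β) < 0 → s i = 1)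
    (h2 : ∀ i : ℕ, 0 < ((i : ℝ) - α) * (i - β) → s i = 0) (i : ℕ) :
    (s i - t i) * r i * (((i : ℝ) - α) * (i - β)) ≤ 0 := by
  have hr := r_pos i
  obtain ⟨ha, hb⟩ := ht i
  rcases lt_trichotomy (((i : ℝ) - α) * (i - β)) 0 with h | h | h
  · rw [h1 i h]
    exact mul_nonpos_of_nonneg_of_nonpos (mul_nonneg (by linarith) hr.le) h.le
  · rw [h]; simp
  · rw [h2 i h]
    exact mul_nonpos_of_nonpos_of_nonneg
      (mul_nonpos_of_nonpos_of_nonneg (by linarith) hr.le) h.le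

lemma lift_sum {k : ℕ} {s t : ℕ → ℝ} (hL : L k s = L k t) (α β : ℝ) :
    ∑ i ∈ Finset.range k, (s i - t i) * r i * (((i : ℝ) - α) * (i - β)) =
      ∑ i ∈ Finset.range k, (s i - t i) * r i * (i : ℝ) ^ 2 := by
  have e0 : ∑ i ∈ Finset.range k, s i * r i = ∑ i ∈ Finset.range k, t i * r i := by
    rw [← L_zero_coord, ← L_zero_coord, hL]
  have e1 : ∑ i ∈ Finset.range k, s i * (r i * i) = ∑ i ∈ Finset.range k, t i * (r i * i) := by
    rw [← L_one_coord, ← L_one_coord, hL]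
  have e : ∀ i ∈ Finset.range k, (s i - t i) * r i * (((i : ℝ) - α) * (i - β)) =
      (s i - t i) * r i * (i : ℝ) ^ 2 + (α * β * (s i * r i) - α * β * (t i * r i))
        + ((α + β) * (t i * (r i * i)) - (α + β) * (s i * (r i * i))) := by
    intro i _; ring
  rw [Finset.sum_congr rfl e]
  simp only [Finset.sum_add_distrib, Finset.sum_sub_distrib, ← Finset.mul_sum, e0, e1]
  ring

lemma cert_unique {k : ℕ} {s t : ℕ → ℝ} (hs : Cert k s) (ht : Cert k t)
    (hL : L k s = L k t) : ∀ i < k, s i = t i := by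
  obtain ⟨hs0, e, hek, α, β, h1, h2, h3⟩ := hs
  obtain ⟨ht0, e', -, α', β', h1', h2', -⟩ := ht
  have A := lift_sum hL α β
  have B := lift_sum hL.symm α' β'
  have B0 : ∑ i ∈ Finset.range k, (t i - s i) * r i * (((i : ℝ) - α') * (i - β')) ≤ 0 :=
    Finset.sum_nonpos fun i _ => lift_term hs0 h1' h2' i
  have D : ∑ i ∈ Finset.range k, (t i - s i) * r i * (i : ℝ) ^ 2 =
      - ∑ i ∈ Finset.range k, (s i - t i) * r i * (i : ℝ) ^ 2 := by
    rw [← Finset.sum_neg_distrib]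
    exact Finset.sum_congr rfl fun i _ => by ring
  have A0 : ∑ i ∈ Finset.range k, (s i - t i) * r i * (((i : ℝ) - α) * (i - β)) ≤ 0 :=
    Finset.sum_nonpos fun i _ => lift_term ht0 h1 h2 i
  have A1 : ∑ i ∈ Finset.range k, (s i - t i) * r i * (((i : ℝ) - α) * (i - β)) = 0 := by
    linarith
  have A2 := (Finset.sum_eq_zero_iff_of_nonpos fun i _ => lift_term ht0 h1 h2 i).1 A1
  have A3 : ∀ i < k, i ≠ e → s i = t i := by
    intro i hi hie
    have := A2 i (Finset.mem_range.2 hi)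
    rcases mul_eq_zero.1 this with h | h
    · rcases mul_eq_zero.1 h with h | h
      · linarith
      · exact absurd h (r_pos i).ne'
    · exact absurd (h3 i h) hie
  have e0 : ∑ i ∈ Finset.range k, s i * r i = ∑ i ∈ Finset.range k, t i * r i := by
    rw [← L_zero_coord, ← L_zero_coord, hL]
  have e1 : ∑ i ∈ Finset.range k, (s i - t i) * r i = 0 := by
    simp only [sub_mul, Finset.sum_sub_distrib, e0, sub_self]
  rw [Finset.sum_eq_single_of_mem e (Finset.mem_range.2 hek)] at e1
  · intro i hi
    by_cases hie : i = e
    · subst hie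
      rcases mul_eq_zero.1 e1 with h | h
      · linarith
      · exact absurd h (r_pos i).ne'
    · exact A3 i hi hie
  · intro i hi hie
    rw [A3 i (Finset.mem_range.1 hi) hie]; simp

/-- point on the edge `(e,m)` with parameter `τ` -/
noncomputable def pt (e m : ℕ) (τ : ℝ) (i : ℕ) : ℝ :=
  if i = e then τ else if i ∈ Finset.uIcc e m then 1 else 0

lemma pt_bd (e m : ℕ) {τ : ℝ} (h0 : 0 ≤ τ) (h1 : τ ≤ 1) (i : ℕ) :
    0 ≤ pt e m τ i ∧ pt e m τ i ≤ 1 := by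
  unfold pt; split_ifs <;> constructor <;> linarith

lemma pt_cert {k e m : ℕ} (he : e < k) {τ : ℝ} (h0 : 0 ≤ τ) (h1 : τ ≤ 1) :
    Cert k (pt e m τ) := by
  refine ⟨pt_bd e m h0 h1, e, he, ?_⟩
  rcases lt_trichotomy m e with hm | hm | hm
  · -- left interval
    have key : ∀ i : ℕ, ((i : ℝ) < e ∧ (m : ℝ) ≤ i) ∨ i = e ∨ (e : ℝ) < i ∨ (i : ℝ) + 1 ≤ m := by
      intro i
      have : (i < e ∧ m ≤ i) ∨ i = e ∨ e < i ∨ i + 1 ≤ m := by omega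
      exact_mod_cast this
    have hm' : (m : ℝ) + 1 ≤ e := by exact_mod_cast hm
    refine ⟨e, (m : ℝ) - 1 / 2, ?_, ?_, ?_⟩ <;> intro i hi <;>
      rcases key i with ⟨h, h'⟩ | h | h | h
    · have : i < e := by exact_mod_cast h
      have : m ≤ i := by exact_mod_cast h'
      rw [pt, if_neg (by omega), if_pos (by rw [Finset.mem_uIcc]; omega)]
    · subst h; simp at hi
    · nlinarith
    · nlinarith
    · nlinarith
    · subst h; simp at hi
    · have : e < i := by exact_mod_cast h
      rw [pt, if_neg (by omega), if_neg (by rw [Finset.mem_uIcc]; omega)]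
    · have : i + 1 ≤ m := by exact_mod_cast h
      rw [pt, if_neg (by omega), if_neg (by rw [Finset.mem_uIcc]; omega)]
    · nlinarith
    · exact h
    · nlinarith
    · nlinarith
  · subst hm
    refine ⟨m, m, ?_, ?_, ?_⟩ <;> intro i hi
    · nlinarith [mul_self_nonneg ((i : ℝ) - m)]
    · have : i ≠ m := by rintro rfl; simp at hi
      simp [pt, this]
    · have : (i : ℝ) = m := by nlinarith [mul_self_eq_zero.1 hi]
      exact_mod_cast this
  · have key : ∀ i : ℕ, ((e : ℝ) < i ∧ (i : ℝ) ≤ m) ∨ i = e ∨ (i : ℝ) < e ∨ (m : ℝ) + 1 ≤ i := by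
      intro i
      have : (e < i ∧ i ≤ m) ∨ i = e ∨ i < e ∨ m + 1 ≤ i := by omega
      exact_mod_cast this
    have hm' : (e : ℝ) + 1 ≤ m := by exact_mod_cast hm
    refine ⟨e, (m : ℝ) + 1 / 2, ?_, ?_, ?_⟩ <;> intro i hi <;>
      rcases key i with ⟨h, h'⟩ | h | h | h
    · have : e < i := by exact_mod_cast h
      have : i ≤ m := by exact_mod_cast h'
      rw [pt, if_neg (by omega), if_pos (by rw [Finset.mem_uIcc]; omega)]
    · subst h; simp at hi
    · nlinarith
    · nlinarith
    · nlinarith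
    · subst h; simp at hi
    · have : i < e := by exact_mod_cast h
      rw [pt, if_neg (by omega), if_neg (by rw [Finset.mem_uIcc]; omega)]
    · have : m + 1 ≤ i := by exact_mod_cast h
      rw [pt, if_neg (by omega), if_neg (by rw [Finset.mem_uIcc]; omega)]
    · nlinarith
    · exact h
    · nlinarith
    · nlinarith

noncomputable def ind (S : Finset ℕ) (i : ℕ) : ℝ := if i ∈ S then 1 else 0

noncomputable def P (k : ℕ) (S : Finset ℕ) : EuclideanSpace ℝ (Fin 2) := L k (ind S)

def up (e m : ℕ) : Finset ℕ := Finset.uIcc e m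
def lo (e m : ℕ) : Finset ℕ := (Finset.uIcc e m).erase e

lemma ind_up (e m : ℕ) : ind (up e m) = pt e m 1 := by
  funext i
  by_cases h : i = e
  · subst h; simp [ind, up, pt]
  · simp [ind, up, pt, h]

lemma ind_lo (e m : ℕ) : ind (lo e m) = pt e m 0 := by
  funext i
  by_cases h : i = e
  · subst h; simp [ind, lo, pt]
  · simp [ind, lo, pt, h]

lemma L_pt (k e m : ℕ) (τ : ℝ) :
    L k (pt e m τ) = (1 - τ) • P k (lo e m) + τ • P k (up e m) := by
  simp only [P, ind_up, ind_lo, L, Finset.smul_sum, ← Finset.sum_add_distrib, smul_smul,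
    ← add_smul]
  refine Finset.sum_congr rfl fun i _ => ?_
  congr 1
  unfold pt; split_ifs <;> ring

lemma L_pt' {k e : ℕ} (he : e < k) (m : ℕ) (τ : ℝ) :
    L k (pt e m τ) = P k (lo e m) + τ • vec e := by
  have : L k (pt e m τ) - P k (lo e m) = τ • vec e := by
    simp only [P, ind_lo, L, ← Finset.sum_sub_distrib, ← sub_smul]
    rw [Finset.sum_eq_single_of_mem e (Finset.mem_range.2 he)]
    · simp [pt]
    · intro i _ hi; simp [pt, hi]
  rw [← this]; abel

/-- the vertices -/
def F (k : ℕ) : Finset (Finset ℕ) :=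
  insert ∅ (((Finset.range k).sigma fun j => Finset.range (j + 1)).image
    fun p => Finset.Icc p.2 p.1)

lemma card_F (k : ℕ) : ((F k).card : ℝ) = 1 + k * (k + 1) / 2 := by
  unfold F
  rw [Finset.card_insert_of_notMem, Finset.card_image_of_injOn, Finset.card_sigma]
  · simp only [Finset.card_range]
    push_cast
    have : ∀ k : ℕ, ∑ x ∈ Finset.range k, ((x : ℝ) + 1) = k * (k + 1) / 2 := by
      intro k
      induction k with
      | zero => simp
      | succ k ih => rw [Finset.sum_range_succ, ih]; push_cast; ring
    rw [this]; ring
  · rintro ⟨a, b⟩ h ⟨a', b'⟩ h' heq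
    simp at h h' heq
    have h1 : b ∈ Finset.Icc b' a' := by rw [← heq]; simp; omega
    have h2 : a ∈ Finset.Icc b' a' := by rw [← heq]; simp; omega
    have h3 : b' ∈ Finset.Icc b a := by rw [heq]; simp; omega
    have h4 : a' ∈ Finset.Icc b a := by rw [heq]; simp; omega
    rw [Finset.mem_Icc] at h1 h2 h3 h4
    have : a = a' := by omega
    have : b = b' := by omega
    subst a; subst b; rfl
  · simp only [Finset.mem_image, not_exists, not_and]
    rintro ⟨a, b⟩ h h'
    simp at h h'
    omega

lemma Icc_mem_F {k a b : ℕ} (hb : b < k) : Finset.Icc a b ∈ F k := by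
  unfold F
  by_cases h : a ≤ b
  · refine Finset.mem_insert_of_mem (Finset.mem_image.2 ⟨⟨b, a⟩, ?_, rfl⟩)
    simp; omega
  · rw [Finset.Icc_eq_empty h]; exact Finset.mem_insert_self _ _

lemma up_mem {k e m : ℕ} (he : e < k) (hm : m < k) : up e m ∈ F k := by
  unfold up Finset.uIcc
  exact Icc_mem_F (by simp; omega)

lemma lo_mem {k e m : ℕ} (he : e < k) (hm : m < k) : lo e m ∈ F k := by
  rcases lt_trichotomy m e with h | h | h
  · have : lo e m = Finset.Icc m (e - 1) := by
      ext i; simp only [lo, Finset.mem_erase, Finset.mem_uIcc, Finset.mem_Icc]; omega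
    rw [this]; exact Icc_mem_F (by omega)
  · subst h; simp [lo, F]
  · have : lo e m = Finset.Icc (e + 1) m := by
      ext i; simp only [lo, Finset.mem_erase, Finset.mem_uIcc, Finset.mem_Icc]; omega
    rw [this]; exact Icc_mem_F (by omega)

lemma mem_F {k : ℕ} (hk : 0 < k) {S : Finset ℕ} (h : S ∈ F k) :
    ∃ e < k, ∃ m < k, S = lo e m ∨ S = up e m := by
  unfold F at h
  rcases Finset.mem_insert.1 h with h | h
  · exact ⟨0, hk, 0, hk, Or.inl (by simp [h, lo])⟩
  · obtain ⟨⟨b, a⟩, hab, rfl⟩ := Finset.mem_image.1 h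
    simp at hab
    exact ⟨a, by omega, b, by omega, Or.inr (by simp [up, Finset.uIcc_of_le (show a ≤ b by omega)])⟩

lemma F_cert {k : ℕ} (hk : 0 < k) {S : Finset ℕ} (h : S ∈ F k) : Cert k (ind S) := by
  obtain ⟨e, he, m, hm, rfl | rfl⟩ := mem_F hk h
  · rw [ind_lo]; exact pt_cert he le_rfl zero_le_one
  · rw [ind_up]; exact pt_cert he zero_le_one le_rfl

lemma F_lt {k : ℕ} {S : Finset ℕ} (h : S ∈ F k) {i : ℕ} (hi : i ∈ S) : i < k := by
  unfold F at h
  rcases Finset.mem_insert.1 h with h | h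
  · simp [h] at hi
  · obtain ⟨⟨b, a⟩, hab, rfl⟩ := Finset.mem_image.1 h
    simp at hab hi
    omega

lemma P_inj {k : ℕ} (hk : 0 < k) {S T : Finset ℕ} (hS : S ∈ F k) (hT : T ∈ F k)
    (h : P k S = P k T) : S = T := by
  have := cert_unique (F_cert hk hS) (F_cert hk hT) h
  ext i
  by_cases hi : i < k
  · have := this i hi
    unfold ind at this
    split_ifs at this <;> simp_all
  · exact ⟨fun h => absurd (F_lt hS h) hi, fun h => absurd (F_lt hT h) hi⟩

lemma eq_of_pt {k e m m' : ℕ} (he : e < k) (hm : m < k) (hm' : m' < k) {τ τ' : ℝ}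
    (h : ∀ i < k, pt e m τ i = pt e m' τ' i) : m = m' := by
  have key : ∀ i < k, i ≠ e → (i ∈ Finset.uIcc e m ↔ i ∈ Finset.uIcc e m') := by
    intro i hi hie
    have := h i hi
    simp only [pt, hie, if_false] at this
    split_ifs at this with h1 h2 h2
    · exact ⟨fun _ => h2, fun _ => h1⟩
    · norm_num at this
    · norm_num at this
    · exact ⟨fun h => absurd h h1, fun h => absurd h h2⟩
  have a := key m hm
  have b := key m' hm'
  simp only [Finset.mem_uIcc] at a b
  omega

lemma mem_seg {k e m : ℕ} {x : EuclideanSpace ℝ (Fin 2)}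
    (hx : x ∈ segment ℝ (P k (lo e m)) (P k (up e m))) :
    ∃ τ : ℝ, 0 ≤ τ ∧ τ ≤ 1 ∧ x = L k (pt e m τ) := by
  obtain ⟨a, b, ha, hb, hab, rfl⟩ := hx
  refine ⟨b, hb, by linarith, ?_⟩
  rw [L_pt, ← hab]; simp

lemma pt_ne_mem {e m i : ℕ} {τ : ℝ} (h : i ≠ e) : pt e m τ i = 0 ∨ pt e m τ i = 1 := by
  simp only [pt, h, if_false]; split_ifs <;> simp

lemma end_mem {k e m : ℕ} {τ : ℝ} (h : τ = 0 ∨ τ = 1) :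
    L k (pt e m τ) ∈ ({P k (lo e m), P k (up e m)} : Set (EuclideanSpace ℝ (Fin 2))) := by
  rcases h with rfl | rfl <;> rw [L_pt] <;> simp

lemma noncross {k e m e' m' : ℕ} (he : e < k) (hm : m < k) (he' : e' < k) (hm' : m' < k)
    (hne : ¬ (e = e' ∧ m = m')) :
    segment ℝ (P k (lo e m)) (P k (up e m)) ∩ segment ℝ (P k (lo e' m')) (P k (up e' m')) ⊆
      ({P k (lo e m), P k (up e m)} ∩ {P k (lo e' m'), P k (up e' m')} :
        Set (EuclideanSpace ℝ (Fin 2))) := by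
  rintro x ⟨hx, hx'⟩
  obtain ⟨τ, h0, h1, rfl⟩ := mem_seg hx
  obtain ⟨τ', h0', h1', h⟩ := mem_seg hx'
  have key := cert_unique (pt_cert he h0 h1) (pt_cert he' h0' h1') h
  have hee : e ≠ e' := by
    rintro rfl
    exact hne ⟨rfl, eq_of_pt he hm hm' key⟩
  refine ⟨end_mem ?_, ?_⟩
  · have := key e he
    have t : pt e m τ e = τ := by simp [pt]
    rw [← t, this]; exact pt_ne_mem hee
  · rw [h]
    refine end_mem ?_
    have := key e' he'
    have t : pt e' m' τ' e' = τ' := by simp [pt]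
    rw [← t, ← this]; exact pt_ne_mem hee.symm

lemma noVertex {k e m : ℕ} (hk : 0 < k) (he : e < k) {S : Finset ℕ} (hS : S ∈ F k) :
    P k S ∉ openSegment ℝ (P k (lo e m)) (P k (up e m)) := by
  rintro ⟨a, b, ha, hb, hab, h⟩
  have h' : L k (pt e m b) = L k (ind S) := by
    change _ = P k S
    rw [L_pt, ← hab]; simpa using h
  have := cert_unique (pt_cert he hb.le (by linarith)) (F_cert hk hS) h' e he
  simp only [pt, ind, if_true] at this
  split_ifs at this <;> linarith

lemma dist_edge {k e : ℕ} (m : ℕ) (he : e < k) : dist (P k (lo e m)) (P k (up e m)) = 1 := by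
  have h : P k (up e m) = P k (lo e m) + (1 : ℝ) • vec e := by
    rw [← L_pt' he, L_pt]; simp
  rw [h, dist_eq_norm]; simp [norm_vec]

lemma card_up (e m : ℕ) : (up e m).card = (lo e m).card + 1 := by
  unfold up lo
  rw [Finset.card_erase_add_one]; simp

/-- Adjacency. -/
def E (k : ℕ) (S T : Finset ℕ) : Prop :=
  ∃ e < k, ∃ m < k, (S = lo e m ∧ T = up e m) ∨ (S = up e m ∧ T = lo e m)

lemma E_parity {k : ℕ} {S T : Finset ℕ} (h : E k S T) : S.card % 2 ≠ T.card % 2 := by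
  obtain ⟨e, -, m, -, ⟨rfl, rfl⟩ | ⟨rfl, rfl⟩⟩ := h <;> rw [card_up] <;> omega

lemma edge_inj {e m e' m' : ℕ} (h : lo e m = lo e' m') (h' : up e m = up e' m') :
    e = e' ∧ m = m' := by
  have he : e = e' := by
    by_contra hne
    have : e ∈ lo e' m' := by
      unfold lo
      rw [Finset.mem_erase]
      refine ⟨hne, ?_⟩
      change e ∈ up e' m'
      rw [← h']; simp [up]
    rw [← h] at this
    simp [lo] at this
  subst he
  refine ⟨rfl, ?_⟩
  have a : m ∈ up e m' := by rw [← h']; simp [up]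
  have b : m' ∈ up e m := by rw [h']; simp [up]
  simp only [up, Finset.mem_uIcc] at a b
  omega

noncomputable def f (k : ℕ) (a : Fin (F k).card) : Finset ℕ := ((F k).equivFin.symm a).1

lemma f_mem (k : ℕ) (a : Fin (F k).card) : f k a ∈ F k := ((F k).equivFin.symm a).2

lemma f_inj (k : ℕ) : Function.Injective (f k) :=
  Subtype.val_injective.comp (F k).equivFin.symm.injective

lemma f_surj {k : ℕ} {S : Finset ℕ} (h : S ∈ F k) : ∃ a, f k a = S :=
  ⟨(F k).equivFin ⟨S, h⟩, by simp [f]⟩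

def G (k : ℕ) : SimpleGraph (Fin (F k).card) where
  Adj a b := E k (f k a) (f k b)
  symm := ⟨by
    rintro a b ⟨e, he, m, hm, h⟩
    exact ⟨e, he, m, hm, by tauto⟩⟩
  loopless := ⟨fun a h => E_parity h rfl⟩

lemma G_free (k : ℕ) : (G k).CliqueFree 3 := by
  intro s hs
  rw [SimpleGraph.is3Clique_iff] at hs
  obtain ⟨a, b, c, hab, hac, hbc, -⟩ := hs
  have h1 := E_parity hab
  have h2 := E_parity hac
  have h3 := E_parity hbc
  omega

lemma G_edges (k : ℕ) : k ^ 2 ≤ (G k).edgeSet.ncard := by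
  classical
  haveI : Nonempty (Fin (F k).card) :=
    ⟨(F k).equivFin ⟨∅, Finset.mem_insert_self _ _⟩⟩
  choose! g hg using fun S (h : S ∈ F k) => f_surj h
  let φ : Fin k × Fin k → Sym2 (Fin (F k).card) := fun p => s(g (lo p.1 p.2), g (up p.1 p.2))
  have hφ : Function.Injective φ := by
    rintro ⟨e, m⟩ ⟨e', m'⟩ h
    have a1 := hg _ (lo_mem e.2 m.2)
    have a2 := hg _ (up_mem e.2 m.2)
    have a3 := hg _ (lo_mem e'.2 m'.2)
    have a4 := hg _ (up_mem e'.2 m'.2)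
    simp only [φ, Sym2.eq_iff] at h
    rcases h with ⟨h1, h2⟩ | ⟨h1, h2⟩
    · have := edge_inj (by rw [← a1, ← a3, h1]) (by rw [← a2, ← a4, h2] : up e m = up e' m')
      exact Prod.ext (Fin.ext this.1) (Fin.ext this.2)
    · have b1 : lo e m = up e' m' := by rw [← a1, ← a4, h1]
      have b2 : up e m = lo e' m' := by rw [← a2, ← a3, h2]
      have c1 := card_up e m
      have c2 := card_up e' m'
      rw [b1, b2] at c1
      omega
  have hsub : Set.range φ ⊆ (G k).edgeSet := by
    rintro _ ⟨⟨e, m⟩, rfl⟩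
    rw [SimpleGraph.mem_edgeSet]
    exact ⟨e, e.2, m, m.2, Or.inl ⟨hg _ (lo_mem e.2 m.2), hg _ (up_mem e.2 m.2)⟩⟩
  have := Set.ncard_le_ncard hsub (Set.toFinite _)
  rw [← Set.image_univ, Set.ncard_image_of_injective _ hφ, Set.ncard_univ] at this
  simpa [sq] using this

lemma G_embed {k : ℕ} (hk : 0 < k) : Nonempty (MatchstickEmbedding (G k)) := by
  refine ⟨⟨fun a => P k (f k a), ?_, ?_, ?_, ?_⟩⟩
  · intro a b h
    exact f_inj k (P_inj hk (f_mem k a) (f_mem k b) h)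
  · rintro u v ⟨e, he, m, hm, ⟨h1, h2⟩ | ⟨h1, h2⟩⟩
    · simp only [h1, h2]; exact dist_edge m he
    · simp only [h1, h2]; rw [dist_comm]; exact dist_edge m he
  · rintro w u v ⟨e, he, m, hm, ⟨h1, h2⟩ | ⟨h1, h2⟩⟩
    · simp only [h1, h2]; exact noVertex hk he (f_mem k w)
    · simp only [h1, h2]; rw [openSegment_symm]; exact noVertex hk he (f_mem k w)
  · rintro u v a b ⟨e, he, m, hm, h⟩ ⟨e', he', m', hm', h'⟩ hne
    have hne' : ¬ (e = e' ∧ m = m') := by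
      rintro ⟨rfl, rfl⟩
      apply hne
      rw [Sym2.eq_iff]
      rcases h with ⟨h1, h2⟩ | ⟨h1, h2⟩ <;> rcases h' with ⟨h3, h4⟩ | ⟨h3, h4⟩
      · exact Or.inl ⟨f_inj k (h1.trans h3.symm), f_inj k (h2.trans h4.symm)⟩
      · exact Or.inr ⟨f_inj k (h1.trans h4.symm), f_inj k (h2.trans h3.symm)⟩
      · exact Or.inr ⟨f_inj k (h1.trans h4.symm), f_inj k (h2.trans h3.symm)⟩
      · exact Or.inl ⟨f_inj k (h1.trans h3.symm), f_inj k (h2.trans h4.symm)⟩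
    have key := noncross he hm he' hm' hne'
    rcases h with ⟨h1, h2⟩ | ⟨h1, h2⟩ <;> rcases h' with ⟨h3, h4⟩ | ⟨h3, h4⟩ <;>
      simp only [h1, h2, h3, h4]
    · exact key
    · rw [segment_symm ℝ (P k (up e' m')), Set.pair_comm (P k (up e' m'))]; exact key
    · rw [segment_symm ℝ (P k (up e m)), Set.pair_comm (P k (up e m))]; exact key
    · rw [segment_symm ℝ (P k (up e m)), Set.pair_comm (P k (up e m)),
        segment_symm ℝ (P k (up e' m')), Set.pair_comm (P k (up e' m'))]; exact key

end MatchstickAux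

/-- For every constant `c > √2` there is a triangle-free matchstick graph on
some number `n` of vertices having more than `2n - c·√n` edges; hence the upper
bound `2n - c√n` fails for every `c > √2`. -/
theorem triangleFree_matchstick_lower_construction (c : ℝ) (hc : Real.sqrt 2 < c) :
    ∃ n : ℕ, 0 < n ∧ ∃ G : SimpleGraph (Fin n),
      G.CliqueFree 3 ∧ Nonempty (MatchstickEmbedding G) ∧
      2 * n - c * Real.sqrt n < (G.edgeSet.ncard : ℝ) := by
  have h2 : 0 < Real.sqrt 2 := by positivity
  have hs : Real.sqrt 2 * Real.sqrt 2 = 2 := Real.mul_self_sqrt (by norm_num)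
  obtain ⟨k, hk⟩ := exists_nat_gt (2 * Real.sqrt 2 / (c - Real.sqrt 2))
  have hk' : 2 * Real.sqrt 2 < k * (c - Real.sqrt 2) := by
    rwa [div_lt_iff₀ (by linarith)] at hk
  have hk0 : 0 < k := by
    rcases Nat.eq_zero_or_pos k with h | h
    · subst h; simp at hk'; linarith
    · exact h
  have hn := MatchstickAux.card_F k
  have hE : ((k : ℝ) ^ 2) ≤ ((MatchstickAux.G k).edgeSet.ncard : ℝ) := by
    exact_mod_cast MatchstickAux.G_edges k
  have hkr : (0 : ℝ) < k := by exact_mod_cast hk0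
  refine ⟨(MatchstickAux.F k).card, ?_, MatchstickAux.G k, MatchstickAux.G_free k,
    MatchstickAux.G_embed hk0, ?_⟩
  · have : (0 : ℝ) < (MatchstickAux.F k).card := by rw [hn]; positivity
    exact_mod_cast this
  · have hroot : (k : ℝ) / Real.sqrt 2 ≤ Real.sqrt (MatchstickAux.F k).card := by
      apply Real.le_sqrt_of_sq_le
      rw [hn, div_pow, Real.sq_sqrt (by norm_num)]
      nlinarith
    have h3 : (k : ℝ) + 2 < c * (k / Real.sqrt 2) := by
      rw [← mul_div_assoc, lt_div_iff₀ h2]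
      linarith
    have h4 : c * (k / Real.sqrt 2) ≤ c * Real.sqrt (MatchstickAux.F k).card :=
      mul_le_mul_of_nonneg_left hroot (by linarith)
    have h5 : 2 * ((MatchstickAux.F k).card : ℝ) = k ^ 2 + k + 2 := by rw [hn]; ring
    linarith
end
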